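/- arXiv:1408.0347 — 10 statements merged into one kernel-verified Lean document; each statement's English description precedes it below -/
import Mathlib

section
/- Let 0 < μ₁ ≤ μ₂ with μ₁ + μ₂ = 1, and let E < 0, L ≥ 0 satisfy E·L² < σ(μ₁,μ₂). Then every admissible state (E₁, E₂, L₁, L₂) with μ₁E₁ + μ₂E₂ = E and μ₁L₁ + μ₂L₂ = L that satisfies the intersection condition √(1 + 2E₁L₁²)·√(1 + 2E₂L₂²) ≥ −(1 + L₂²E₁ + L₁²E₂) has E₁ < 0 and E₂ < 0, i.e. both orbits are elliptic. -/
/-- The critical eccentricity `e = (√((μ₁/μ₂)⁴ + 8(μ₁/μ₂)²) − (μ₁/μ₂)²)/4`. -/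
noncomputable def eCrit (μ₁ μ₂ : ℝ) : ℝ :=
  (Real.sqrt ((μ₁ / μ₂) ^ 4 + 8 * (μ₁ / μ₂) ^ 2) - (μ₁ / μ₂) ^ 2) / 4

/-- The critical constant `σ(μ₁,μ₂) = −(1−e²)(μ₁² + μ₂²e)²/(2μ₂e²)`. -/
noncomputable def sigma (μ₁ μ₂ : ℝ) : ℝ :=
  -((1 - (eCrit μ₁ μ₂) ^ 2) * (μ₁ ^ 2 + μ₂ ^ 2 * eCrit μ₁ μ₂) ^ 2) /
    (2 * μ₂ * (eCrit μ₁ μ₂) ^ 2)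

lemma eCrit_pos {μ₁ μ₂ : ℝ} (h₁ : 0 < μ₁) (h₂ : 0 < μ₂) : 0 < eCrit μ₁ μ₂ := by
  have hr : 0 < μ₁ / μ₂ := div_pos h₁ h₂
  have : (μ₁ / μ₂) ^ 2 < Real.sqrt ((μ₁ / μ₂) ^ 4 + 8 * (μ₁ / μ₂) ^ 2) :=
    Real.lt_sqrt_of_sq_lt (by nlinarith [pow_pos hr 2])
  unfold eCrit
  linarith

lemma eCrit_equation {μ₁ μ₂ : ℝ} (h₂ : 0 < μ₂) :
    2 * μ₂ ^ 2 * eCrit μ₁ μ₂ ^ 2 = μ₁ ^ 2 * (1 - eCrit μ₁ μ₂) := by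
  have hs := Real.sq_sqrt (show 0 ≤ (μ₁ / μ₂) ^ 4 + 8 * (μ₁ / μ₂) ^ 2 by positivity)
  have hμ : μ₁ ^ 2 = μ₂ ^ 2 * (μ₁ / μ₂) ^ 2 := by field_simp
  have key : 2 * eCrit μ₁ μ₂ ^ 2 = (μ₁ / μ₂) ^ 2 * (1 - eCrit μ₁ μ₂) := by
    unfold eCrit
    linear_combination hs / 8
  linear_combination μ₂ ^ 2 * key - (1 - eCrit μ₁ μ₂) * hμ

/-- With `e = 1 - 2v²` the critical constant becomes `-2μ₂³(1 - v²)³/v²`. -/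
lemma exists_sigma_eq {μ₁ μ₂ : ℝ} (h₁ : 0 < μ₁) (h₂ : 0 < μ₂) :
    ∃ v : ℝ, 0 < v ∧ 2 * v ^ 2 < 1 ∧ μ₁ * v = μ₂ * (1 - 2 * v ^ 2) ∧
      sigma μ₁ μ₂ = -(2 * μ₂ ^ 3 * (1 - v ^ 2) ^ 3 / v ^ 2) := by
  have he := eCrit_pos h₁ h₂
  have heq := eCrit_equation (μ₁ := μ₁) h₂
  unfold sigma
  generalize eCrit μ₁ μ₂ = e at *
  have he1 : e < 1 := by
    have : 0 < μ₁ ^ 2 * (1 - e) := by rw [← heq]; positivity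
    linarith [pos_of_mul_pos_right this (by positivity)]
  have hv2 := Real.sq_sqrt (show 0 ≤ (1 - e) / 2 by linarith)
  have hv : 0 < Real.sqrt ((1 - e) / 2) := Real.sqrt_pos.2 (by linarith)
  generalize Real.sqrt ((1 - e) / 2) = v at *
  obtain rfl : e = 1 - 2 * v ^ 2 := by linarith
  have hrel : μ₁ * v = μ₂ * (1 - 2 * v ^ 2) := by
    have : (μ₁ * v) ^ 2 = (μ₂ * (1 - 2 * v ^ 2)) ^ 2 := by linear_combination -heq / 2
    exact (pow_left_inj₀ (by positivity) (by positivity) two_ne_zero).1 this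
  refine ⟨v, hv, by linarith, hrel, ?_⟩
  have hμ : μ₁ = μ₂ * (1 - 2 * v ^ 2) / v := by rw [← hrel]; field_simp
  have hne : 1 - 2 * v ^ 2 ≠ 0 := he.ne'
  rw [hμ]
  field_simp
  ring

/-- `-σ` dominates `-E L²` for a parabolic first orbit tangent to an elliptic second one. -/
lemma le_neg_sigma {μ₁ μ₂ w : ℝ} (h₁ : 0 < μ₁) (h₂ : 0 < μ₂) (hw : 0 ≤ w) :
    2 * μ₂ * (1 - w ^ 2) * (μ₂ * w + μ₁) ^ 2 ≤ -sigma μ₁ μ₂ := by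
  obtain ⟨v, hv, hv1, hrel, hσ⟩ := exists_sigma_eq h₁ h₂
  rw [hσ, neg_neg, le_div_iff₀ (by positivity)]
  have key : 2 * μ₂ ^ 3 * (1 - v ^ 2) ^ 3 - 2 * μ₂ * (1 - w ^ 2) * (μ₂ * w + μ₁) ^ 2 * v ^ 2
      = 2 * μ₂ ^ 3 * ((w - v) ^ 2 *
        (v ^ 2 * w ^ 2 + 2 * v * (1 - v ^ 2) * w + (1 - v ^ 2 - (v ^ 2) ^ 2))) := by
    have : μ₁ = μ₂ * (1 - 2 * v ^ 2) / v := by rw [← hrel]; field_simp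
    rw [this]
    field_simp
    ring
  have h1 : 0 ≤ 1 - v ^ 2 := by nlinarith
  have h2 : 0 ≤ 1 - v ^ 2 - (v ^ 2) ^ 2 := by nlinarith
  have : 0 ≤ 2 * μ₂ ^ 3 * ((w - v) ^ 2 *
      (v ^ 2 * w ^ 2 + 2 * v * (1 - v ^ 2) * w + (1 - v ^ 2 - (v ^ 2) ^ 2))) := by positivity
  linarith

lemma sixteen_mul_le {a b w : ℝ} (ha : 0 < a) (hab : a ≤ b) (hw : 0 ≤ w) :
    16 * a * (1 - w ^ 2) * (a * w + b) ^ 2 ≤ 3 * b * (b + 2 * a) ^ 2 := by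
  obtain ⟨d, hd, rfl⟩ : ∃ d, 0 ≤ d ∧ b = a + d := ⟨b - a, by linarith, by ring⟩
  have h0 : 0 ≤ 27 - 16 * (1 - w ^ 2) * (w + 1) ^ 2 := by
    nlinarith [mul_nonneg (sq_nonneg (2 * w - 1)) (show 0 ≤ 4 * w ^ 2 + 12 * w + 11 by positivity)]
  have h1 : 0 ≤ 45 - 32 * (1 - w ^ 2) * (w + 1) := by
    nlinarith [mul_nonneg hw (sq_nonneg (3 * w - 1)), sq_nonneg (3 * w - 1)]
  have h2 : 0 ≤ 21 - 16 * (1 - w ^ 2) := by nlinarith [sq_nonneg w]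
  have : 3 * (a + d) * (a + d + 2 * a) ^ 2 - 16 * a * (1 - w ^ 2) * (a * w + (a + d)) ^ 2
      = a ^ 3 * (27 - 16 * (1 - w ^ 2) * (w + 1) ^ 2)
        + a ^ 2 * d * (45 - 32 * (1 - w ^ 2) * (w + 1))
        + a * d ^ 2 * (21 - 16 * (1 - w ^ 2)) + 3 * d ^ 3 := by ring
  have : 0 ≤ a ^ 3 * (27 - 16 * (1 - w ^ 2) * (w + 1) ^ 2)
        + a ^ 2 * d * (45 - 32 * (1 - w ^ 2) * (w + 1))
        + a * d ^ 2 * (21 - 16 * (1 - w ^ 2)) + 3 * d ^ 3 := by positivity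
  linarith

/-- The mass ordering makes the configuration with the heavier body on the ellipse extremal. -/
lemma swap_le_neg_sigma {μ₁ μ₂ w : ℝ} (h₁ : 0 < μ₁) (h₁₂ : μ₁ ≤ μ₂) (hw : 0 ≤ w) :
    2 * μ₁ * (1 - w ^ 2) * (μ₁ * w + μ₂) ^ 2 ≤ -sigma μ₁ μ₂ := by
  have h := le_neg_sigma h₁ (h₁.trans_le h₁₂) (w := 1 / 2) (by norm_num)
  linarith [sixteen_mul_le h₁ h₁₂ hw]

/-- Moving the second point down to `1` at fixed weighted mean. -/
lemma exists_tangent_parabola {k j s t : ℝ} (hk : 0 < k) (hj : 0 < j) (hkj : k + j = 1)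
    (hs : 0 ≤ s) (ht : 1 ≤ t) :
    ∃ w, 0 ≤ w ∧
      2 * (1 - k * s ^ 2 - j * t ^ 2) * (k * s + j * t) ^ 2
        ≤ 2 * k * (1 - w ^ 2) * (k * w + j) ^ 2 := by
  obtain ⟨d, hd⟩ : ∃ d, d = j / k * (t - 1) := ⟨_, rfl⟩
  have hkd : k * d = j * (t - 1) := by rw [hd]; field_simp
  have hd0 : 0 ≤ d := by rw [hd]; have := sub_nonneg.2 ht; positivity
  have hm : k * s + j * t = k * (s + d) + j := by linear_combination -hkd
  by_cases hw : s + d ≤ 1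
  · refine ⟨s + d, by positivity, ?_⟩
    rw [hm]
    refine mul_le_mul_of_nonneg_right ?_ (sq_nonneg _)
    have hle : k * d * (2 * s + d) ≤ k * d * (t + 1) :=
      mul_le_mul_of_nonneg_left (by linarith) (by positivity)
    linear_combination 2 * hle + 2 * (t + 1) * hkd - 2 * hkj
  · refine ⟨1, zero_le_one, ?_⟩
    have hmean : 1 ≤ k * s + j * t := by rw [hm]; nlinarith
    have hjensen : (k * s + j * t) ^ 2 ≤ k * s ^ 2 + j * t ^ 2 := by
      obtain rfl : j = 1 - k := by linarith
      nlinarith [mul_nonneg (mul_nonneg hk.le hj.le) (sq_nonneg (s - t))]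
    have : 2 * (1 - k * s ^ 2 - j * t ^ 2) * (k * s + j * t) ^ 2 ≤ 0 :=
      mul_nonpos_of_nonpos_of_nonneg (by nlinarith) (sq_nonneg _)
    simpa using this

/-- Intersecting orbits: with the elliptic apocentre distance `1 / (2m)`, the angular momentum
and the energy of the other orbit are constrained. -/
lemma unbound_energy_ge {m x y Ek Ej p q : ℝ} (hm : 0 < m) (hx : 0 ≤ x) (hy : 0 ≤ y)
    (hp : 0 ≤ p) (hEj : 0 ≤ Ej) (hEk : Ek = -(m * (1 + x))) (hq : 2 * m * q = 1 - x)
    (hyp : y ^ 2 = 1 + 2 * Ej * p) (hint : -(1 + q * Ej + p * Ek) ≤ x * y) :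
    2 * m * (m * p - 1) ≤ Ej := by
  rcases hp.eq_or_lt with rfl | hp
  · nlinarith
  have hpos : 0 < m * p := by positivity
  have hroots : (2 * m * p - (1 + y)) * (2 * m * p * (1 + x) - (1 - x) * (1 - y)) ≤ 0 := by
    have h := mul_le_mul_of_nonneg_left hint (show 0 ≤ 4 * (m * p) by positivity)
    rw [hEk] at h
    linear_combination h + 2 * p * Ej * hq - (1 - x) * hyp
  have hP : 2 * m * p ≤ 1 + y := by
    by_contra! hcon
    have : 0 < 2 * m * p * (1 + x) - (1 - x) * (1 - y) := by nlinarith [mul_nonneg hx hy]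
    nlinarith [mul_pos (sub_pos.2 hcon) this]
  by_contra! hcon
  have h1 : 0 < m * p - 1 := by
    by_contra! h
    nlinarith
  nlinarith [mul_lt_mul_of_pos_right hcon hp]

/-- The product `-E L²` is bounded by its value for a tangent parabola and ellipse. -/
lemma exists_neg_energy_le {k j Ek Ej Lk Lj : ℝ} (hk : 0 < k) (hj : 0 < j) (hkj : k + j = 1)
    (hEk : Ek < 0) (hEj : 0 ≤ Ej) (hE : k * Ek + j * Ej < 0)
    (hL : 0 ≤ k * Lk + j * Lj)
    (hadm : 0 ≤ 1 + 2 * Ek * Lk ^ 2)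
    (hint : -(1 + Lk ^ 2 * Ej + Lj ^ 2 * Ek) ≤
      Real.sqrt (1 + 2 * Ek * Lk ^ 2) * Real.sqrt (1 + 2 * Ej * Lj ^ 2)) :
    ∃ w, 0 ≤ w ∧ -((k * Ek + j * Ej) * (k * Lk + j * Lj) ^ 2)
      ≤ 2 * k * (1 - w ^ 2) * (k * w + j) ^ 2 := by
  have hx := Real.sqrt_nonneg (1 + 2 * Ek * Lk ^ 2)
  have hx2 := Real.sq_sqrt hadm
  have hy := Real.sqrt_nonneg (1 + 2 * Ej * Lj ^ 2)
  have hy2 := Real.sq_sqrt (show 0 ≤ 1 + 2 * Ej * Lj ^ 2 by positivity)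
  generalize Real.sqrt (1 + 2 * Ek * Lk ^ 2) = x at *
  generalize Real.sqrt (1 + 2 * Ej * Lj ^ 2) = y at *
  obtain ⟨g, hg, hgE⟩ : ∃ g : ℝ, 0 < g ∧ Ek = -(g ^ 2 * (1 + x)) := by
    have hpos : 0 < -Ek / (1 + x) := div_pos (by linarith) (by linarith)
    refine ⟨_, Real.sqrt_pos.2 hpos, ?_⟩
    rw [Real.sq_sqrt hpos.le]
    field_simp
  have hsx : 2 * g ^ 2 * Lk ^ 2 = 1 - x := by
    have : (1 + x) * (2 * g ^ 2 * Lk ^ 2) = (1 + x) * (1 - x) := by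
      rw [hgE] at hx2
      linear_combination hx2
    exact mul_left_cancel₀ (by positivity) this
  have hEj' := unbound_energy_ge (by positivity) hx hy (sq_nonneg Lj) hEj hgE hsx hy2 hint
  have hs2 : (g * |Lk|) ^ 2 = g ^ 2 * Lk ^ 2 := by rw [mul_pow, sq_abs]
  have ht2 : (g * |Lj|) ^ 2 = g ^ 2 * Lj ^ 2 := by rw [mul_pow, sq_abs]
  obtain ⟨t, ht⟩ : ∃ t, t = max (g * |Lj|) 1 := ⟨_, rfl⟩
  have htE : 2 * g ^ 2 * (t ^ 2 - 1) ≤ Ej := by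
    rcases max_choice (g * |Lj|) 1 with h | h <;> rw [ht, h]
    · rwa [ht2]
    · simpa using hEj
  obtain ⟨w, hw, h⟩ := exists_tangent_parabola hk hj hkj
    (by positivity : 0 ≤ g * |Lk|) (ht ▸ le_max_right _ _ : 1 ≤ t)
  refine ⟨w, hw, le_trans ?_ h⟩
  have hLle : g * (k * Lk + j * Lj) ≤ k * (g * |Lk|) + j * t := by
    have h1 : k * (g * Lk) ≤ k * (g * |Lk|) := by gcongr; exact le_abs_self _
    have h2 : j * (g * Lj) ≤ j * t := by
      rw [ht]
      gcongr
      exact le_max_of_le_left (by gcongr; exact le_abs_self _)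
    linarith
  have hLsq : g ^ 2 * (k * Lk + j * Lj) ^ 2 ≤ (k * (g * |Lk|) + j * t) ^ 2 := by
    rw [← mul_pow]
    gcongr
  have hEle : -(k * Ek + j * Ej) ≤ g ^ 2 * (2 * (1 - k * (g * |Lk|) ^ 2 - j * t ^ 2)) := by
    rw [hs2, hgE]
    linear_combination j * htE + k * g ^ 2 * hsx + 2 * g ^ 2 * hkj
  have hfac : 0 ≤ 2 * (1 - k * (g * |Lk|) ^ 2 - j * t ^ 2) :=
    (pos_of_mul_pos_right (by linarith) (sq_nonneg g)).le
  calc -((k * Ek + j * Ej) * (k * Lk + j * Lj) ^ 2)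
      = -(k * Ek + j * Ej) * (k * Lk + j * Lj) ^ 2 := by ring
    _ ≤ g ^ 2 * (2 * (1 - k * (g * |Lk|) ^ 2 - j * t ^ 2)) * (k * Lk + j * Lj) ^ 2 := by gcongr
    _ = 2 * (1 - k * (g * |Lk|) ^ 2 - j * t ^ 2) * (g ^ 2 * (k * Lk + j * Lj) ^ 2) := by ring
    _ ≤ _ := by gcongr

theorem invariant_region_elliptic
    (μ₁ μ₂ E L E₁ E₂ L₁ L₂ : ℝ)
    (hμ₁ : 0 < μ₁) (hμ₁₂ : μ₁ ≤ μ₂) (hsum : μ₁ + μ₂ = 1)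
    (hE : E < 0) (hL : 0 ≤ L) (hσ : E * L ^ 2 < sigma μ₁ μ₂)
    (hadm₁ : 1 + 2 * E₁ * L₁ ^ 2 ≥ 0) (hadm₂ : 1 + 2 * E₂ * L₂ ^ 2 ≥ 0)
    (hEmean : μ₁ * E₁ + μ₂ * E₂ = E) (hLmean : μ₁ * L₁ + μ₂ * L₂ = L)
    (hint : Real.sqrt (1 + 2 * E₁ * L₁ ^ 2) * Real.sqrt (1 + 2 * E₂ * L₂ ^ 2) ≥
      -(1 + L₂ ^ 2 * E₁ + L₁ ^ 2 * E₂)) :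
    E₁ < 0 ∧ E₂ < 0 := by
  have hμ₂ : 0 < μ₂ := hμ₁.trans_le hμ₁₂
  subst hEmean hLmean
  by_contra hcon
  have hcases : E₁ < 0 ∧ 0 ≤ E₂ ∨ E₂ < 0 ∧ 0 ≤ E₁ := by
    rcases lt_or_ge E₁ 0 with h1 | h1 <;> rcases lt_or_ge E₂ 0 with h2 | h2
    · exact absurd ⟨h1, h2⟩ hcon
    · exact Or.inl ⟨h1, h2⟩
    · exact Or.inr ⟨h2, h1⟩
    · exact absurd hE (not_lt.2 (by positivity))
  rcases hcases with ⟨h1, h2⟩ | ⟨h2, h1⟩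
  · obtain ⟨w, hw, h⟩ := exists_neg_energy_le hμ₁ hμ₂ hsum h1 h2 hE hL hadm₁
      (by linarith)
    linarith [swap_le_neg_sigma hμ₁ hμ₁₂ hw]
  · obtain ⟨w, hw, h⟩ := exists_neg_energy_le (Lk := L₂) (Lj := L₁) hμ₂ hμ₁
      (by linarith) h2 h1
      (by linarith) (by linarith) hadm₂ (by linarith)
    rw [add_comm (μ₂ * E₂), add_comm (μ₂ * L₂)] at h
    linarith [le_neg_sigma hμ₁ hμ₂ hw]
end

section
/- Let 0 < μ₁ ≤ μ₂ with μ₁ + μ₂ = 1, and let E < 0, L ≥ 0 satisfy E·L² < σ(μ₁,μ₂). Then there exist constants c ∈ [0,1) and B > 0, depending only on μ₁, μ₂, E, L, such that every admissible state (E₁, E₂, L₁, L₂) with μ₁E₁ + μ₂E₂ = E and μ₁L₁ + μ₂L₂ = L satisfying the intersection condition √(1 + 2E₁L₁²)·√(1 + 2E₂L₂²) ≥ −(1 + L₂²E₁ + L₁²E₂) has eccentricities e₁ ≤ c, e₂ ≤ c and angular momenta |L₁| ≤ B, |L₂| ≤ B. -/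
/-- The value of `-2EL²` for mass fractions `m, n` at a tangential configuration of the two orbits,
as a function of the square roots `u, s` of `1 ± e₁, 1 ∓ e₂`. -/
def tangentValue (m n u s : ℝ) : ℝ :=
  (2 - m * u ^ 2 - n * s ^ 2) * (m * u + n * s) ^ 2

lemma tangentValue_comm (m n u s : ℝ) : tangentValue m n u s = tangentValue n m s u := by
  unfold tangentValue
  ring

/-- Two intersecting co-focal conics satisfy the mutual perihelion–aphelion inequalities. -/
lemma apsidal_inequalities {E₁ E₂ a b e f : ℝ} (ha : 0 < a) (hb : 0 < b) (he : 0 ≤ e)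
    (hf : 0 ≤ f) (he2 : e ^ 2 = 1 + 2 * E₁ * a ^ 2) (hf2 : f ^ 2 = 1 + 2 * E₂ * b ^ 2)
    (h : -(1 + b ^ 2 * E₁ + a ^ 2 * E₂) ≤ e * f) :
    a ^ 2 * (1 - f) ≤ b ^ 2 * (1 + e) ∧ b ^ 2 * (1 - e) ≤ a ^ 2 * (1 + f) := by
  have hprod : 0 ≤ (2 * a ^ 2 * b ^ 2) * (e * f + (1 + b ^ 2 * E₁ + a ^ 2 * E₂)) := by
    apply mul_nonneg (by positivity); linarith
  have hsq : (a ^ 2 - b ^ 2) ^ 2 ≤ (b ^ 2 * e + a ^ 2 * f) ^ 2 := by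
    have : (b ^ 2 * e + a ^ 2 * f) ^ 2 - (a ^ 2 - b ^ 2) ^ 2 =
        (2 * a ^ 2 * b ^ 2) * (e * f + (1 + b ^ 2 * E₁ + a ^ 2 * E₂)) := by
      linear_combination b ^ 4 * he2 + a ^ 4 * hf2
    linarith
  have habs := abs_le_of_sq_le_sq' hsq (by positivity)
  constructor <;> linarith [habs.1, habs.2]

lemma convexOn_weighted_energy {m n α β : ℝ} (hm : 0 < m) (hn : 0 < n) (hα : 0 ≤ α)
    (hβ : 0 ≤ β) :
    ConvexOn ℝ (Set.Ioi (0 : ℝ)) fun x => α * (m + n * x⁻¹) ^ 2 + β * (m * x + n) ^ 2 := by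
  have hid : ConvexOn ℝ (Set.Ioi (0 : ℝ)) fun x : ℝ => x := convexOn_id (convex_Ioi 0)
  have hinv : ConvexOn ℝ (Set.Ioi (0 : ℝ)) fun x : ℝ => x⁻¹ := by
    simpa using convexOn_zpow (𝕜 := ℝ) (-1)
  have h₁ : ConvexOn ℝ (Set.Ioi (0 : ℝ)) fun x : ℝ => m + n * x⁻¹ := by
    exact (convexOn_const m (convex_Ioi 0)).add (hinv.smul hn.le)
  have h₂ : ConvexOn ℝ (Set.Ioi (0 : ℝ)) fun x : ℝ => m * x + n := by
    exact (hid.smul hm.le).add (convexOn_const n (convex_Ioi 0))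
  have h₁' := (h₁.pow (fun x (hx : 0 < x) => by positivity) 2).smul hα
  have h₂' := (h₂.pow (fun x (hx : 0 < x) => by positivity) 2).smul hβ
  exact h₁'.add h₂'

lemma neg_two_energy_mul_sq {m n E₁ E₂ a b e f : ℝ} (ha : 0 < a) (hb : 0 < b)
    (he2 : e ^ 2 = 1 + 2 * E₁ * a ^ 2) (hf2 : f ^ 2 = 1 + 2 * E₂ * b ^ 2) :
    -2 * (m * E₁ + n * E₂) * (m * a + n * b) ^ 2 =
      (m * (1 - e ^ 2)) * (m + n * (a / b)⁻¹) ^ 2 + (n * (1 - f ^ 2)) * (m * (a / b) + n) ^ 2 := by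
  rw [he2, hf2]
  field_simp
  ring

lemma weighted_energy_eq_tangentValue {m n u s : ℝ} (hu : 0 < u) (hs : 0 < s) :
    (m * (u ^ 2 * (2 - u ^ 2))) * (m + n * (u / s)⁻¹) ^ 2 +
      (n * (s ^ 2 * (2 - s ^ 2))) * (m * (u / s) + n) ^ 2 = (m + n) * (m * u + n * s) ^ 2 * 2
      - (m * u ^ 2 + n * s ^ 2) * (m * u + n * s) ^ 2 := by
  field_simp
  ring

lemma le_tangentValue_of_pos_of_lt {m n E₁ E₂ a b e f : ℝ} (hm : 0 < m) (hn : 0 < n)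
    (hmn : m + n = 1) (ha : 0 < a) (hb : 0 < b) (he : 0 ≤ e)
    (hf : 0 ≤ f) (he2 : e ^ 2 = 1 + 2 * E₁ * a ^ 2) (hf2 : f ^ 2 = 1 + 2 * E₂ * b ^ 2)
    (hf1 : f < 1) (h : -(1 + b ^ 2 * E₁ + a ^ 2 * E₂) ≤ e * f) :
    -2 * (m * E₁ + n * E₂) * (m * a + n * b) ^ 2 ≤ tangentValue m n √(1 + e) √(1 - f) ∨
    (e ≤ 1 ∧ -2 * (m * E₁ + n * E₂) * (m * a + n * b) ^ 2 ≤
      tangentValue m n √(1 - e) √(1 + f)) := by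
  obtain ⟨hup, hlo⟩ := apsidal_inequalities ha hb he hf he2 hf2 h
  have value : ∀ {u s : ℝ}, 0 < u → 0 < s → u ^ 2 * (2 - u ^ 2) = 1 - e ^ 2 →
      s ^ 2 * (2 - s ^ 2) = 1 - f ^ 2 →
      (m * (1 - e ^ 2)) * (m + n * (u / s)⁻¹) ^ 2 + (n * (1 - f ^ 2)) * (m * (u / s) + n) ^ 2 =
        tangentValue m n u s := by
    intro u s hu hs h1 h2
    rw [← h1, ← h2, weighted_energy_eq_tangentValue hu hs, hmn]
    unfold tangentValue
    ring
  have hu : 0 < √(1 + e) := Real.sqrt_pos.2 (by linarith)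
  have hs : 0 < √(1 - f) := Real.sqrt_pos.2 (by linarith)
  have hu2 : √(1 + e) ^ 2 = 1 + e := Real.sq_sqrt (by linarith)
  have hs2 : √(1 - f) ^ 2 = 1 - f := Real.sq_sqrt (by linarith)
  have hx₁ : a / b ≤ √(1 + e) / √(1 - f) := by
    rw [div_le_div_iff₀ hb hs]
    refine (abs_le_of_sq_le_sq' ?_ (by positivity)).2
    rw [mul_pow, mul_pow, hu2, hs2]
    linarith
  have v₁ := value hu hs (by rw [hu2]; ring) (by rw [hs2]; ring)
  have hx : 0 < a / b := by positivity
  rw [neg_two_energy_mul_sq ha hb he2 hf2]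
  rcases lt_or_ge e 1 with he1 | he1
  · have hv : 0 < √(1 - e) := Real.sqrt_pos.2 (by linarith)
    have ht : 0 < √(1 + f) := Real.sqrt_pos.2 (by linarith)
    have hv2 : √(1 - e) ^ 2 = 1 - e := Real.sq_sqrt (by linarith)
    have ht2 : √(1 + f) ^ 2 = 1 + f := Real.sq_sqrt (by linarith)
    have hx₀ : √(1 - e) / √(1 + f) ≤ a / b := by
      rw [div_le_div_iff₀ ht hb]
      refine (abs_le_of_sq_le_sq' ?_ (by positivity)).2
      rw [mul_pow, mul_pow, hv2, ht2]
      linarith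
    have v₀ := value hv ht (by rw [hv2]; ring) (by rw [ht2]; ring)
    have hα : 0 ≤ m * (1 - e ^ 2) := mul_nonneg hm.le (sub_nonneg.2 (pow_le_one₀ he he1.le))
    have hβ : 0 ≤ n * (1 - f ^ 2) := mul_nonneg hn.le (sub_nonneg.2 (pow_le_one₀ hf hf1.le))
    have hmax := (convexOn_weighted_energy hm hn hα hβ).le_max_of_mem_Icc
      (show √(1 - e) / √(1 + f) ∈ Set.Ioi (0 : ℝ) from div_pos hv ht)
      (show √(1 + e) / √(1 - f) ∈ Set.Ioi (0 : ℝ) from div_pos hu hs) ⟨hx₀, hx₁⟩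
    simp only [v₀, v₁] at hmax
    rcases le_max_iff.1 hmax with h' | h'
    · exact Or.inr ⟨he1.le, h'⟩
    · exact Or.inl h'
  · left
    rw [← v₁]
    have hα : m * (1 - e ^ 2) ≤ 0 := mul_nonpos_of_nonneg_of_nonpos hm.le
      (sub_nonpos.2 (one_le_pow₀ he1))
    have hβ : 0 ≤ n * (1 - f ^ 2) := mul_nonneg hn.le (sub_nonneg.2 (pow_le_one₀ hf hf1.le))
    apply add_le_add
    · apply mul_le_mul_of_nonpos_left _ hα
      gcongr
    · gcongr

/-- An intersecting pair of orbits with total energy `m * E₁ + n * E₂ < 0` is dominated by one of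
the two tangential configurations with the same eccentricities. -/
lemma le_tangentValue {m n E₁ E₂ a b e f : ℝ} (hm : 0 < m) (hn : 0 < n)
    (hmn : m + n = 1) (ha : 0 ≤ a) (hb : 0 ≤ b) (hab : 0 < m * a + n * b) (he : 0 ≤ e)
    (hf : 0 ≤ f) (he2 : e ^ 2 = 1 + 2 * E₁ * a ^ 2) (hf2 : f ^ 2 = 1 + 2 * E₂ * b ^ 2)
    (hE : m * E₁ + n * E₂ < 0)
    (h : -(1 + b ^ 2 * E₁ + a ^ 2 * E₂) ≤ e * f) :
    (f ≤ 1 ∧ -2 * (m * E₁ + n * E₂) * (m * a + n * b) ^ 2 ≤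
      tangentValue m n √(1 + e) √(1 - f)) ∨
    (e ≤ 1 ∧ -2 * (m * E₁ + n * E₂) * (m * a + n * b) ^ 2 ≤
      tangentValue m n √(1 - e) √(1 + f)) := by
  have degenerate : ∀ {m n E₁ E₂ b e f : ℝ}, 0 < m → m + n = 1 → 0 ≤ f → e = 1 →
      f ^ 2 = 1 + 2 * E₂ * b ^ 2 → -(1 + b ^ 2 * E₁) ≤ e * f →
      -2 * (m * E₁ + n * E₂) * (n * b) ^ 2 ≤ tangentValue m n √(1 - e) √(1 + f) := by
    intro m n E₁ E₂ b e f hm hmn hf he hf2 h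
    subst he
    unfold tangentValue
    rw [sub_self, Real.sqrt_zero, mul_zero, zero_add, mul_pow n √(1 + f) 2,
      Real.sq_sqrt (by linarith)]
    have hn : m = 1 - n := by linarith
    have key : (2 - m * 0 ^ 2 - n * (1 + f)) * (n ^ 2 * (1 + f)) -
        -2 * (m * E₁ + n * E₂) * (n * b) ^ 2 =
        2 * m * n ^ 2 * (1 * f + (1 + b ^ 2 * E₁)) := by
      subst hn
      linear_combination -n ^ 3 * hf2
    have : 0 ≤ 2 * m * n ^ 2 * (1 * f + (1 + b ^ 2 * E₁)) :=
      mul_nonneg (by positivity) (by linarith)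
    linarith
  rcases ha.eq_or_lt with rfl | ha
  · have he1 : e = 1 := by nlinarith
    right
    refine ⟨he1.le, ?_⟩
    simpa using degenerate (n := n) (E₂ := E₂) (b := b) hm hmn hf he1 hf2 (by simpa using h)
  rcases hb.eq_or_lt with rfl | hb
  · have hf1 : f = 1 := by nlinarith
    left
    refine ⟨hf1.le, ?_⟩
    rw [tangentValue_comm]
    have := degenerate (n := m) (E₁ := E₂) (E₂ := E₁) (b := a) (f := e) hn
      (by linarith) he hf1 he2 (by simpa [mul_comm e f] using h)
    simpa [add_comm] using this
  rcases lt_or_ge f 1 with hf1 | hf1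
  · rcases le_tangentValue_of_pos_of_lt hm hn hmn ha hb he hf he2 hf2 hf1 h with h' | h'
    · exact Or.inl ⟨hf1.le, h'⟩
    · exact Or.inr h'
  · have he1 : e < 1 := by
      by_contra! hc
      have h₁ : 0 ≤ E₁ := by
        by_contra! hneg
        nlinarith [mul_pos (neg_pos.2 hneg) (pow_pos ha 2)]
      have h₂ : 0 ≤ E₂ := by
        by_contra! hneg
        nlinarith [mul_pos (neg_pos.2 hneg) (pow_pos hb 2)]
      linarith [mul_nonneg hm.le h₁, mul_nonneg hn.le h₂]
    have := le_tangentValue_of_pos_of_lt hn hm (by linarith) hb ha hf he hf2 he2 he1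
      (by linarith [mul_comm e f])
    rw [tangentValue_comm n m, tangentValue_comm n m, add_comm (n * b), add_comm (n * E₂)] at this
    rcases this with h' | h'
    · exact Or.inr ⟨he1.le, h'⟩
    · exact Or.inl h'

lemma eCrit_spec {μ₁ μ₂ : ℝ} (h₁ : 0 < μ₁) (h₂ : 0 < μ₂) :
    0 < eCrit μ₁ μ₂ ∧ eCrit μ₁ μ₂ < 1 ∧
      2 * eCrit μ₁ μ₂ ^ 2 * μ₂ ^ 2 = μ₁ ^ 2 * (1 - eCrit μ₁ μ₂) := by
  have hr : 0 < (μ₁ / μ₂) ^ 2 := by positivity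
  have hk : (μ₁ / μ₂) ^ 2 * μ₂ ^ 2 = μ₁ ^ 2 := by field_simp
  have hdef : eCrit μ₁ μ₂ =
    (√((μ₁ / μ₂) ^ 4 + 8 * (μ₁ / μ₂) ^ 2) - (μ₁ / μ₂) ^ 2) / 4 := rfl
  rw [show (μ₁ / μ₂) ^ 4 = ((μ₁ / μ₂) ^ 2) ^ 2 by ring] at hdef
  generalize (μ₁ / μ₂) ^ 2 = k at *
  generalize eCrit μ₁ μ₂ = e at *
  have hq : √(k ^ 2 + 8 * k) = 4 * e + k := by linarith
  have hq2 : k ^ 2 + 8 * k = (4 * e + k) ^ 2 := by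
    rw [← hq, Real.sq_sqrt (by positivity)]
  have hpos : 0 < 4 * e + k := hq ▸ Real.sqrt_pos.2 (by positivity)
  have hquad : 2 * e ^ 2 = k * (1 - e) := by linarith
  refine ⟨?_, ?_, ?_⟩
  · by_contra! hc
    nlinarith
  · by_contra! hc
    nlinarith
  · rw [← hk, hquad]
    ring

lemma optimal_tangency {w s : ℝ} (hw : 0 ≤ w) (hw1 : w ≤ 1) (hs : 0 ≤ s) :
    (2 - s ^ 2) * (2 * (1 - w ^ 2) + s * w) ^ 2 ≤ (2 - w ^ 2) ^ 3 := by
  have hw2 : w ^ 2 ≤ 1 := pow_le_one₀ hw hw1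
  have key : (2 - w ^ 2) ^ 3 - (2 - s ^ 2) * (2 * (1 - w ^ 2) + s * w) ^ 2 =
      (s - w) ^ 2 * (2 * (1 - w ^ 2) * (2 + w ^ 2) + 4 * (w * s) + w ^ 2 * (s - w) ^ 2) := by
    ring
  have : 0 ≤ (s - w) ^ 2 *
      (2 * (1 - w ^ 2) * (2 + w ^ 2) + 4 * (w * s) + w ^ 2 * (s - w) ^ 2) := by
    have : 0 ≤ 1 - w ^ 2 := by linarith
    positivity
  linarith

lemma tangentValue_parabolic_le {μ₁ μ₂ s : ℝ} (h₁ : 0 < μ₁) (h₂ : 0 < μ₂) (hs : 0 ≤ s) :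
    μ₂ * (2 - s ^ 2) * (μ₁ * √2 + μ₂ * s) ^ 2 ≤ -2 * sigma μ₁ μ₂ := by
  obtain ⟨he0, he1, hspec⟩ := eCrit_spec h₁ h₂
  unfold sigma
  generalize eCrit μ₁ μ₂ = e at *
  have hw : 0 < √(1 - e) := Real.sqrt_pos.2 (by linarith)
  have hw1 : √(1 - e) ≤ 1 := Real.sqrt_le_one.2 (by linarith)
  have hw2 : √(1 - e) ^ 2 = 1 - e := Real.sq_sqrt (by linarith)
  have hopt := optimal_tangency hw.le hw1 hs
  have hroot : μ₁ * √2 * √(1 - e) = 2 * e * μ₂ := by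
    rw [← sq_eq_sq₀ (by positivity) (by positivity), mul_pow, mul_pow, hw2,
      Real.sq_sqrt (by norm_num)]
    linarith
  have hval : -2 * (-((1 - e ^ 2) * (μ₁ ^ 2 + μ₂ ^ 2 * e) ^ 2) / (2 * μ₂ * e ^ 2)) =
      μ₂ ^ 3 * (1 + e) ^ 3 / (1 - e) := by
    have hne : 1 - e ≠ 0 := by linarith
    have hμ : μ₁ ^ 2 = 2 * e ^ 2 * μ₂ ^ 2 / (1 - e) := by
      rw [eq_div_iff hne]; linarith
    rw [hμ]
    field_simp
    ring
  rw [hval, le_div_iff₀ (by linarith)]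
  rw [hw2] at hopt
  calc μ₂ * (2 - s ^ 2) * (μ₁ * √2 + μ₂ * s) ^ 2 * (1 - e)
      = μ₂ * (2 - s ^ 2) * (μ₁ * √2 * √(1 - e) + μ₂ * s * √(1 - e)) ^ 2 := by
        linear_combination -(μ₂ * (2 - s ^ 2) * (μ₁ * √2 + μ₂ * s) ^ 2) * hw2
    _ = μ₂ ^ 3 * ((2 - s ^ 2) * (2 * (1 - (1 - e)) + s * √(1 - e)) ^ 2) := by
        rw [hroot]; ring
    _ ≤ μ₂ ^ 3 * (2 - (1 - e)) ^ 3 := by gcongr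
    _ = μ₂ ^ 3 * (1 + e) ^ 3 := by ring

lemma tangentValue_parabolic_swap_le {μ₁ μ₂ s : ℝ} (h₁ : 0 < μ₁) (h₁₂ : μ₁ ≤ μ₂)
    (hs : 0 ≤ s) :
    μ₁ * (2 - s ^ 2) * (μ₂ * √2 + μ₁ * s) ^ 2 ≤ -2 * sigma μ₁ μ₂ := by
  have h₂ : 0 < μ₂ := h₁.trans_le h₁₂
  obtain ⟨t, rfl⟩ : ∃ t, s = √2 * t := ⟨s / √2, by field_simp⟩
  have ht : 0 ≤ t := nonneg_of_mul_nonneg_right hs (by positivity)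
  have h2 : √2 ^ 2 = (2 : ℝ) := Real.sq_sqrt (by norm_num)
  have scale : ∀ p q r : ℝ, p * (2 - (√2 * r) ^ 2) * (q * √2 + p * (√2 * r)) ^ 2 =
      4 * (p * (1 - r ^ 2) * (q + p * r) ^ 2) := by
    intro p q r
    linear_combination (p * (q + p * r) ^ 2 * (2 - r ^ 2 * (√2 ^ 2 + 2))) * h2
  have bound : ∀ {r : ℝ}, 0 ≤ r →
      4 * (μ₂ * (1 - r ^ 2) * (μ₁ + μ₂ * r) ^ 2) ≤ -2 * sigma μ₁ μ₂ := by
    intro r hr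
    rw [← scale]
    exact tangentValue_parabolic_le h₁ h₂ (by positivity)
  rw [scale]
  rcases le_total t 1 with ht1 | ht1
  · rcases le_total t (1 / 3) with ht3 | ht3
    · refine le_trans ?_ (bound (r := 1 / 2) (by norm_num))
      have hfirst : (1 - t ^ 2) * (μ₂ + μ₁ * t) ^ 2 ≤ μ₂ ^ 2 + 2 * μ₁ * μ₂ * t := by
        have : 0 ≤ t ^ 2 * (μ₂ ^ 2 - μ₁ ^ 2) + t ^ 2 * (2 * μ₁ * μ₂ * t + μ₁ ^ 2 * t ^ 2) := by
          have : 0 ≤ μ₂ ^ 2 - μ₁ ^ 2 := by nlinarith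
          positivity
        linarith
      have hsecond : 2 * μ₁ * μ₂ * t ≤ 2 * μ₁ * μ₂ * (1 / 3) := by gcongr
      have hthird := mul_le_mul_of_nonneg_left (hfirst.trans (add_le_add_right hsecond _)) h₁.le
      nlinarith [mul_nonneg h₂.le (sq_nonneg (2 * μ₁ - 3 * μ₂))]
    · refine le_trans ?_ (bound ht)
      have key : μ₂ * (1 - t ^ 2) * (μ₁ + μ₂ * t) ^ 2 - μ₁ * (1 - t ^ 2) * (μ₂ + μ₁ * t) ^ 2 =
          (1 - t ^ 2) * ((μ₂ - μ₁) * (t ^ 2 * (μ₂ - μ₁) ^ 2 +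
            μ₁ * μ₂ * ((3 * t - 1) * (t + 1)))) := by
        ring
      have h3 : 0 ≤ 3 * t - 1 := by linarith
      have h4 : 0 ≤ 1 - t ^ 2 := by nlinarith
      have h5 : 0 ≤ μ₂ - μ₁ := by linarith
      have : 0 ≤ (1 - t ^ 2) * ((μ₂ - μ₁) * (t ^ 2 * (μ₂ - μ₁) ^ 2 +
            μ₁ * μ₂ * ((3 * t - 1) * (t + 1)))) := by positivity
      linarith
  · refine le_trans ?_ (bound (r := 1) (by norm_num))
    have : 0 ≤ μ₁ * (μ₂ + μ₁ * t) ^ 2 * (t ^ 2 - 1) :=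
      mul_nonneg (by positivity) (by nlinarith)
    linarith

lemma lt_neg_two_sigma {μ₁ μ₂ : ℝ} (h₁ : 0 < μ₁) (h₂ : 0 < μ₂) (hsum : μ₁ + μ₂ = 1) :
    μ₂ < -2 * sigma μ₁ μ₂ := by
  have h := tangentValue_parabolic_le h₁ h₂ (zero_le_one)
  have hroot : (1 : ℝ) < √2 := Real.one_lt_sqrt_two
  have hM : 1 < μ₁ * √2 + μ₂ * 1 := by nlinarith
  have : 1 < (μ₁ * √2 + μ₂ * 1) ^ 2 := one_lt_pow₀ hM (by norm_num)
  nlinarith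

lemma tangentValue_le_of_sqrt_two_le {m n u s K : ℝ} (hm : 0 < m) (hn : 0 < n) (hmn : m + n = 1)
    (hK : 0 ≤ K) (hpar : ∀ t, 0 ≤ t → n * (2 - t ^ 2) * (m * √2 + n * t) ^ 2 ≤ K)
    (hu : √2 ≤ u) (hs : 0 ≤ s) : tangentValue m n u s ≤ K := by
  rcases le_or_gt 2 (m * u ^ 2 + n * s ^ 2) with hA | hA
  · refine le_trans ?_ hK
    exact mul_nonpos_of_nonpos_of_nonneg (by linarith) (sq_nonneg _)
  have h2 : √2 ^ 2 = (2 : ℝ) := Real.sq_sqrt (by norm_num)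
  obtain ⟨t, ht⟩ : ∃ t, n * t = n * s + m * (u - √2) :=
    ⟨(n * s + m * (u - √2)) / n, by field_simp⟩
  have hst : s ≤ t := by
    have := mul_nonneg hm.le (sub_nonneg.2 hu)
    exact le_of_mul_le_mul_left (by linarith) hn
  have hM : m * u + n * s = m * √2 + n * t := by linarith
  have hvar : ∀ x y : ℝ, m * x ^ 2 + n * y ^ 2 = (m * x + n * y) ^ 2 + m * n * (x - y) ^ 2 := by
    intro x y
    have : m = 1 - n := by linarith
    subst this
    ring
  have hM2 : m * u + n * s < √2 := by
    apply Real.lt_sqrt_of_sq_lt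
    have := hvar u s
    have : 0 ≤ m * n * (u - s) ^ 2 := by positivity
    linarith
  have ht2 : t ≤ √2 := by
    have : n * t ≤ n * √2 := by
      have : m * √2 + n * √2 = √2 := by rw [← add_mul, hmn, one_mul]
      linarith
    exact le_of_mul_le_mul_left this hn
  have hA' : m * √2 ^ 2 + n * t ^ 2 ≤ m * u ^ 2 + n * s ^ 2 := by
    rw [hvar, hvar u s, hM]
    have : (√2 - t) ^ 2 ≤ (u - s) ^ 2 := by
      apply pow_le_pow_left₀ <;> linarith
    gcongr
  refine le_trans ?_ (hpar t (hs.trans hst))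
  unfold tangentValue
  rw [hM]
  apply mul_le_mul_of_nonneg_right _ (sq_nonneg _)
  rw [h2] at hA'
  linarith

lemma tangentValue_zero_le {m n s : ℝ} (hn : 0 < n) : tangentValue m n 0 s ≤ n := by
  unfold tangentValue
  nlinarith [mul_nonneg hn.le (sq_nonneg (n * s ^ 2 - 1))]

/-- Superlevel sets of `tangentValue` above the critical value lie in a compact part of the open
square `0 < u², s² < 2`. -/
lemma exists_uniform_bound {m n K₀ K : ℝ} (hm : 0 < m) (hn : 0 < n) (hmn : m + n = 1)
    (hmK : m ≤ K₀) (hnK : n ≤ K₀)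
    (hpar : ∀ t, 0 ≤ t → n * (2 - t ^ 2) * (m * √2 + n * t) ^ 2 ≤ K₀)
    (hpar' : ∀ t, 0 ≤ t → m * (2 - t ^ 2) * (n * √2 + m * t) ^ 2 ≤ K₀) (hK : K₀ < K) :
    ∃ c : ℝ, 0 ≤ c ∧ c < 1 ∧ ∀ u s : ℝ, 0 ≤ u → 0 ≤ s → K ≤ tangentValue m n u s →
      |u ^ 2 - 1| ≤ c ∧ |s ^ 2 - 1| ≤ c := by
  have interior : ∀ {m n u s : ℝ}, 0 < m → 0 < n → m + n = 1 → n ≤ K₀ →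
      (∀ t, 0 ≤ t → n * (2 - t ^ 2) * (m * √2 + n * t) ^ 2 ≤ K₀) → 0 ≤ u → 0 ≤ s →
      K ≤ tangentValue m n u s → 0 < u ∧ u < √2 := by
    intro m n u s hm hn hmn hnK hpar hu hs h
    constructor
    · rcases hu.eq_or_lt with rfl | hu
      · linarith [tangentValue_zero_le (m := m) (s := s) hn]
      · exact hu
    · by_contra! hc
      linarith [tangentValue_le_of_sqrt_two_le hm hn hmn (by linarith) hpar hc hs]
  have interior₂ : ∀ {u s : ℝ}, 0 ≤ u → 0 ≤ s → K ≤ tangentValue m n u s →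
      (0 < u ∧ u < √2) ∧ 0 < s ∧ s < √2 := fun hu hs h =>
    ⟨interior hm hn hmn hnK hpar hu hs h,
      interior hn hm (by linarith) hmK hpar' hs hu (tangentValue_comm m n _ _ ▸ h)⟩
  let S : Set (ℝ × ℝ) := (Set.Icc 0 √2 ×ˢ Set.Icc 0 √2) ∩ {x | K ≤ tangentValue m n x.1 x.2}
  have hS : IsCompact S := by
    apply (isCompact_Icc.prod isCompact_Icc).inter_right
    apply isClosed_le continuous_const
    unfold tangentValue
    fun_prop
  have memS : ∀ {u s : ℝ}, 0 ≤ u → 0 ≤ s → K ≤ tangentValue m n u s → (u, s) ∈ S := by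
    intro u s hu hs h
    obtain ⟨hu', hs'⟩ := interior₂ hu hs h
    exact ⟨⟨⟨hu, hu'.2.le⟩, ⟨hs, hs'.2.le⟩⟩, h⟩
  rcases S.eq_empty_or_nonempty with hemp | hne
  · refine ⟨0, le_rfl, one_pos, fun u s hu hs h => ?_⟩
    have := memS hu hs h
    simp [hemp] at this
  · obtain ⟨x, hxS, hmax⟩ := hS.exists_isMaxOn hne
      (f := fun x : ℝ × ℝ => max |x.1 ^ 2 - 1| |x.2 ^ 2 - 1|) (by fun_prop)
    have lt_one : ∀ {y : ℝ}, 0 < y ∧ y < √2 → |y ^ 2 - 1| < 1 := by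
      intro y hy
      have h2 : √2 ^ 2 = (2 : ℝ) := Real.sq_sqrt (by norm_num)
      have hlt : y ^ 2 < √2 ^ 2 := pow_lt_pow_left₀ hy.2 hy.1.le (by norm_num)
      have := pow_pos hy.1 2
      rw [abs_lt]
      constructor <;> linarith
    obtain ⟨hx₁, hx₂⟩ := interior₂ hxS.1.1.1 hxS.1.2.1 hxS.2
    refine ⟨max |x.1 ^ 2 - 1| |x.2 ^ 2 - 1|, le_max_of_le_left (abs_nonneg _),
      max_lt (lt_one hx₁) (lt_one hx₂), fun u s hu hs h => ?_⟩
    exact max_le_iff.1 (hmax (memS hu hs h))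

lemma abs_le_of_intersecting {m n E₁ E₂ a b e f c : ℝ} (hm : 0 < m) (hn : 0 < n)
    (hmn : m + n = 1) (ha : 0 < a) (hb : 0 < b) (he : 0 ≤ e) (hf : 0 ≤ f)
    (he2 : e ^ 2 = 1 + 2 * E₁ * a ^ 2) (hf2 : f ^ 2 = 1 + 2 * E₂ * b ^ 2) (hc : c < 1)
    (hec : e ≤ c) (hfc : f ≤ c) (hE : m * E₁ + n * E₂ < 0)
    (h : -(1 + b ^ 2 * E₁ + a ^ 2 * E₂) ≤ e * f) :
    a ≤ 1 + 1 / ((1 - c) * -(m * E₁ + n * E₂)) := by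
  obtain ⟨hup, hlo⟩ := apsidal_inequalities ha hb he hf he2 hf2 h
  have hc' : 0 < 1 - c := by linarith
  have hE' : 0 < -(m * E₁ + n * E₂) := by linarith
  set X := 1 / ((1 - c) * -(m * E₁ + n * E₂)) with hX
  have hX0 : 0 < X := by positivity
  have hratio : a ^ 2 * (1 - c) ≤ 2 * b ^ 2 := by
    have : a ^ 2 * (1 - c) ≤ a ^ 2 * (1 - f) := by gcongr
    nlinarith [pow_pos hb 2]
  have hE1 : a ^ 2 * (1 - c) * -(2 * E₁) ≤ 2 := by
    nlinarith [sq_nonneg e, pow_pos ha 2]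
  have hE2 : a ^ 2 * (1 - c) * -(2 * E₂) ≤ 2 := by
    rcases le_total E₂ 0 with h0 | h0
    · have := mul_le_mul_of_nonneg_right hratio (show 0 ≤ -(2 * E₂) by linarith)
      nlinarith [sq_nonneg f]
    · have : 0 ≤ a ^ 2 * (1 - c) * (2 * E₂) := by positivity
      linarith
  have hsq : a ^ 2 ≤ X := by
    rw [hX, le_div_iff₀ (by positivity)]
    have h₁ := mul_le_mul_of_nonneg_left hE1 hm.le
    have h₂ := mul_le_mul_of_nonneg_left hE2 hn.le
    nlinarith
  refine (abs_le_of_sq_le_sq' ?_ (by linarith)).2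
  nlinarith

theorem invariant_region_bounds
    (μ₁ μ₂ E L : ℝ)
    (hμ₁ : 0 < μ₁) (hμ₁₂ : μ₁ ≤ μ₂) (hsum : μ₁ + μ₂ = 1)
    (hE : E < 0) (hL : 0 ≤ L) (hσ : E * L ^ 2 < sigma μ₁ μ₂) :
    ∃ c B : ℝ, 0 ≤ c ∧ c < 1 ∧ 0 < B ∧
      ∀ E₁ E₂ L₁ L₂ : ℝ,
        1 + 2 * E₁ * L₁ ^ 2 ≥ 0 → 1 + 2 * E₂ * L₂ ^ 2 ≥ 0 →
        μ₁ * E₁ + μ₂ * E₂ = E → μ₁ * L₁ + μ₂ * L₂ = L →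
        Real.sqrt (1 + 2 * E₁ * L₁ ^ 2) * Real.sqrt (1 + 2 * E₂ * L₂ ^ 2) ≥
          -(1 + L₂ ^ 2 * E₁ + L₁ ^ 2 * E₂) →
        Real.sqrt (1 + 2 * E₁ * L₁ ^ 2) ≤ c ∧ Real.sqrt (1 + 2 * E₂ * L₂ ^ 2) ≤ c ∧
          |L₁| ≤ B ∧ |L₂| ≤ B := by
  have hμ₂ : 0 < μ₂ := hμ₁.trans_le hμ₁₂
  have hK₀ := lt_neg_two_sigma hμ₁ hμ₂ hsum
  have hLpos : 0 < L := by
    rcases hL.eq_or_lt with rfl | hL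
    · simp only [ne_eq, OfNat.ofNat_ne_zero, not_false_eq_true, zero_pow, mul_zero] at hσ
      linarith
    · exact hL
  obtain ⟨c, hc0, hc1, hc⟩ := exists_uniform_bound (K := -2 * (E * L ^ 2)) hμ₁ hμ₂ hsum
    (by linarith) hK₀.le (fun t => tangentValue_parabolic_le hμ₁ hμ₂)
    (fun t => tangentValue_parabolic_swap_le hμ₁ hμ₁₂) (by linarith)
  have hc1' : 0 < 1 - c := by linarith
  have hE' : 0 < -E := by linarith
  refine ⟨c, 1 + 1 / ((1 - c) * -E), hc0, hc1, by positivity, ?_⟩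
  intro E₁ E₂ L₁ L₂ h₁ h₂ hEE hLL h
  have he2 := Real.sq_sqrt h₁
  have hf2 := Real.sq_sqrt h₂
  have he0 := Real.sqrt_nonneg (1 + 2 * E₁ * L₁ ^ 2)
  have hf0 := Real.sqrt_nonneg (1 + 2 * E₂ * L₂ ^ 2)
  generalize √(1 + 2 * E₁ * L₁ ^ 2) = e at *
  generalize √(1 + 2 * E₂ * L₂ ^ 2) = f at *
  rw [← sq_abs L₁, ← sq_abs L₂] at h
  rw [← sq_abs L₁] at he2
  rw [← sq_abs L₂] at hf2
  have hLabs : L ≤ μ₁ * |L₁| + μ₂ * |L₂| := by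
    rw [← hLL]
    gcongr <;> exact le_abs_self _
  have hLsq : -2 * (E * L ^ 2) ≤
      -2 * (μ₁ * E₁ + μ₂ * E₂) * (μ₁ * |L₁| + μ₂ * |L₂|) ^ 2 := by
    rw [hEE, ← mul_assoc]
    apply mul_le_mul_of_nonneg_left _ (by linarith)
    gcongr
  have hecc : e ≤ c ∧ f ≤ c := by
    rcases le_tangentValue hμ₁ hμ₂ hsum (abs_nonneg L₁) (abs_nonneg L₂) (by linarith) he0 hf0
      he2 hf2 (by linarith) h with ⟨hf1, h'⟩ | ⟨he1, h'⟩
    · have := hc _ _ (Real.sqrt_nonneg _) (Real.sqrt_nonneg _) (hLsq.trans h')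
      rw [Real.sq_sqrt (by linarith), Real.sq_sqrt (by linarith), abs_le, abs_le] at this
      constructor <;> linarith [this.1.2, this.2.1]
    · have := hc _ _ (Real.sqrt_nonneg _) (Real.sqrt_nonneg _) (hLsq.trans h')
      rw [Real.sq_sqrt (by linarith), Real.sq_sqrt (by linarith), abs_le, abs_le] at this
      constructor <;> linarith [this.1.1, this.2.2]
  have habs : ∀ {x y z : ℝ}, y ^ 2 = 1 + 2 * z * |x| ^ 2 → 0 ≤ y → y ≤ c → 0 < |x| := by
    intro x y z hxy hy hyc
    rcases (abs_nonneg x).eq_or_lt with h0 | h0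
    · rw [← h0] at hxy
      nlinarith
    · exact h0
  have ha := habs he2 he0 hecc.1
  have hb := habs hf2 hf0 hecc.2
  have hB₁ := abs_le_of_intersecting hμ₁ hμ₂ hsum ha hb he0 hf0 he2 hf2 hc1 hecc.1 hecc.2
    (by linarith) h
  have hB₂ := abs_le_of_intersecting hμ₂ hμ₁ (by linarith) hb ha hf0 he0 hf2 he2 hc1 hecc.2
    hecc.1 (by linarith) (by linarith [mul_comm e f])
  rw [hEE] at hB₁
  rw [add_comm (μ₂ * E₂), hEE] at hB₂
  exact ⟨hecc.1, hecc.2, hB₁, hB₂⟩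
end

section
/- Let μ₁, μ₂ > 0 with μ₁ + μ₂ = 1, E < 0, L ≥ 0. If an admissible state (E₁, E₂, L₁, L₂) with μ₁E₁ + μ₂E₂ = E and μ₁L₁ + μ₂L₂ = L satisfies the intersection condition √(1 + 2E₁L₁²)·√(1 + 2E₂L₂²) ≥ −(1 + L₂²E₁ + L₁²E₂), then 1 + 2E(μ₁L₁² + μ₂L₂²) ≥ 0; equivalently, writing L₁ = L + μ₂δL and L₂ = L − μ₁δL, it holds that 1 + 2E(L² + μ₁μ₂·δL²) ≥ 0. -/
theorem intersection_implies_momentum_bound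
    (μ₁ μ₂ E L E₁ E₂ L₁ L₂ : ℝ)
    (hμ₁ : 0 < μ₁) (hμ₂ : 0 < μ₂) (hsum : μ₁ + μ₂ = 1)
    (hE : E < 0) (hL : 0 ≤ L)
    (hadm₁ : 1 + 2 * E₁ * L₁ ^ 2 ≥ 0) (hadm₂ : 1 + 2 * E₂ * L₂ ^ 2 ≥ 0)
    (hEmean : μ₁ * E₁ + μ₂ * E₂ = E) (hLmean : μ₁ * L₁ + μ₂ * L₂ = L)
    (hint : Real.sqrt (1 + 2 * E₁ * L₁ ^ 2) * Real.sqrt (1 + 2 * E₂ * L₂ ^ 2) ≥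
      -(1 + L₂ ^ 2 * E₁ + L₁ ^ 2 * E₂)) :
    1 + 2 * E * (μ₁ * L₁ ^ 2 + μ₂ * L₂ ^ 2) ≥ 0 ∧
      1 + 2 * E * (L ^ 2 + μ₁ * μ₂ * (L₁ - L₂) ^ 2) ≥ 0 := by
  have hmom : L ^ 2 + μ₁ * μ₂ * (L₁ - L₂) ^ 2 = μ₁ * L₁ ^ 2 + μ₂ * L₂ ^ 2 := by
    obtain rfl : μ₂ = 1 - μ₁ := by linarith
    rw [← hLmean]
    ring
  rw [hmom, and_self]
  set e₁ := Real.sqrt (1 + 2 * E₁ * L₁ ^ 2)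
  set e₂ := Real.sqrt (1 + 2 * E₂ * L₂ ^ 2)
  have hsq₁ : e₁ ^ 2 = 1 + 2 * E₁ * L₁ ^ 2 := Real.sq_sqrt hadm₁
  have hsq₂ : e₂ ^ 2 = 1 + 2 * E₂ * L₂ ^ 2 := Real.sq_sqrt hadm₂
  have hexpand : 1 + 2 * E * (μ₁ * L₁ ^ 2 + μ₂ * L₂ ^ 2) = (μ₁ * e₁ - μ₂ * e₂) ^ 2 +
      2 * (μ₁ * μ₂) * (e₁ * e₂ + (1 + L₂ ^ 2 * E₁ + L₁ ^ 2 * E₂)) := by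
    have hone : (μ₁ + μ₂) ^ 2 = 1 := by rw [hsum, one_pow]
    rw [← hEmean]
    linear_combination -hone - μ₁ ^ 2 * hsq₁ - μ₂ ^ 2 * hsq₂
  have hnonneg : 0 ≤ e₁ * e₂ + (1 + L₂ ^ 2 * E₁ + L₁ ^ 2 * E₂) := by linarith
  rw [hexpand]
  positivity
end

section
/- Let μ₁, μ₂ > 0 with μ₁ + μ₂ = 1, and let E, δE, L, δL be real numbers. Set E₁ = E + μ₂δE, E₂ = E − μ₁δE, L₁ = L + μ₂δL, L₂ = L − μ₁δL. Then the inequality (1 + 2E₁L₁²)(1 + 2E₂L₂²) ≥ (1 + L₂²E₁ + L₁²E₂)² holds if and only if δE²(μ₁L₁² + μ₂L₂²)² − 2δE(L₁² − L₂²)(1 + E(μ₁L₁² + μ₂L₂²)) + E²(L₁² − L₂²)² ≤ 0. -/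
/-- The difference of the two sides of the intersection condition, as a quadratic form in the mean
energy `E` and the energy difference `δE`; here `a` and `b` are the squared angular momenta. -/
theorem intersection_discriminant_eq {R : Type*} [CommRing R] {μ₁ μ₂ : R} (hsum : μ₁ + μ₂ = 1)
    (E δE a b : R) :
    (1 + b * (E + μ₂ * δE) + a * (E - μ₁ * δE)) ^ 2 -
        (1 + 2 * (E + μ₂ * δE) * a) * (1 + 2 * (E - μ₁ * δE) * b) =
      δE ^ 2 * (μ₁ * a + μ₂ * b) ^ 2 -
        2 * δE * (a - b) * (1 + E * (μ₁ * a + μ₂ * b)) + E ^ 2 * (a - b) ^ 2 := by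
  obtain rfl : μ₂ = 1 - μ₁ := eq_sub_of_add_eq' hsum
  ring

theorem intersection_condition_equivalence
    (μ₁ μ₂ E δE L δL : ℝ)
    (hμ₁ : 0 < μ₁) (hμ₂ : 0 < μ₂) (hsum : μ₁ + μ₂ = 1) :
    let E₁ := E + μ₂ * δE
    let E₂ := E - μ₁ * δE
    let L₁ := L + μ₂ * δL
    let L₂ := L - μ₁ * δL
    ((1 + 2 * E₁ * L₁ ^ 2) * (1 + 2 * E₂ * L₂ ^ 2) ≥
        (1 + L₂ ^ 2 * E₁ + L₁ ^ 2 * E₂) ^ 2) ↔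
      (δE ^ 2 * (μ₁ * L₁ ^ 2 + μ₂ * L₂ ^ 2) ^ 2 -
        2 * δE * (L₁ ^ 2 - L₂ ^ 2) * (1 + E * (μ₁ * L₁ ^ 2 + μ₂ * L₂ ^ 2)) +
        E ^ 2 * (L₁ ^ 2 - L₂ ^ 2) ^ 2 ≤ 0) := by
  intro E₁ E₂ L₁ L₂
  rw [ge_iff_le, ← sub_nonpos, intersection_discriminant_eq hsum]
end

section
/- Let L₁ ≠ 0, L₂ ≠ 0 and E₁, E₂ be real numbers with 1 + 2E₁L₁² ≥ 0 and 1 + 2E₂L₂² ≥ 0, let eᵢ = √(1 + 2EᵢLᵢ²), and let δω ∈ ℝ. Then there exists θ ∈ ℝ with L₁²(1 + e₂·cos(θ + δω)) = L₂²(1 + e₁·cos θ) if and only if e₁e₂·cos δω ≤ 1 + L₂²E₁ + L₁²E₂. (This equation expresses that the two co-focal conics r = Lᵢ²/(1 + eᵢ cos θᵢ), whose periapsis directions differ by the angle δω, have a common point.) -/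
/-- A linear combination of `cos` and `sin` attains exactly the values bounded by its amplitude. -/
theorem exists_mul_cos_add_mul_sin_eq_iff (A B C : ℝ) :
    (∃ θ : ℝ, A * Real.cos θ + B * Real.sin θ = C) ↔ C ^ 2 ≤ A ^ 2 + B ^ 2 := by
  constructor
  · rintro ⟨θ, rfl⟩
    nlinarith [sq_nonneg (A * Real.sin θ - B * Real.cos θ), Real.sin_sq_add_cos_sq θ]
  · intro h
    let z : ℂ := ⟨A, B⟩
    have hA : ‖z‖ * Real.cos z.arg = A := Complex.norm_mul_cos_arg z
    have hB : ‖z‖ * Real.sin z.arg = B := Complex.norm_mul_sin_arg z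
    have hC : |C| ≤ ‖z‖ := by
      refine abs_le_of_sq_le_sq ?_ (norm_nonneg z)
      rw [Complex.sq_norm, Complex.normSq_apply]
      simpa [z, sq] using h
    refine ⟨z.arg + Real.arccos (C / ‖z‖), ?_⟩
    have hcos : ‖z‖ * Real.cos (Real.arccos (C / ‖z‖)) = C := by
      rcases (norm_nonneg z).eq_or_lt with hz | hz
      · rw [← hz] at hC ⊢
        simp [abs_nonpos_iff.mp hC]
      · have hb := abs_le.mp hC
        rw [Real.cos_arccos (by rw [le_div_iff₀ hz]; linarith) (by rw [div_le_one hz]; exact hb.2)]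
        field_simp
    rw [← hA, ← hB, Real.cos_add, Real.sin_add]
    linear_combination hcos +
      ‖z‖ * Real.cos (Real.arccos (C / ‖z‖)) * Real.sin_sq_add_cos_sq z.arg

theorem cofocal_conics_intersection_criterion
    (E₁ E₂ L₁ L₂ δω : ℝ)
    (hL₁ : L₁ ≠ 0) (hL₂ : L₂ ≠ 0)
    (hadm₁ : 1 + 2 * E₁ * L₁ ^ 2 ≥ 0) (hadm₂ : 1 + 2 * E₂ * L₂ ^ 2 ≥ 0) :
    let e₁ := Real.sqrt (1 + 2 * E₁ * L₁ ^ 2)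
    let e₂ := Real.sqrt (1 + 2 * E₂ * L₂ ^ 2)
    ((∃ θ : ℝ, L₁ ^ 2 * (1 + e₂ * Real.cos (θ + δω)) = L₂ ^ 2 * (1 + e₁ * Real.cos θ)) ↔
      e₁ * e₂ * Real.cos δω ≤ 1 + L₂ ^ 2 * E₁ + L₁ ^ 2 * E₂) := by
  intro e₁ e₂
  have he₁ : e₁ ^ 2 = 1 + 2 * E₁ * L₁ ^ 2 := Real.sq_sqrt hadm₁
  have he₂ : e₂ ^ 2 = 1 + 2 * E₂ * L₂ ^ 2 := Real.sq_sqrt hadm₂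
  have hpos : 0 < 2 * (L₁ ^ 2 * L₂ ^ 2) := by positivity
  have hlin : ∀ θ : ℝ,
      L₁ ^ 2 * (1 + e₂ * Real.cos (θ + δω)) = L₂ ^ 2 * (1 + e₁ * Real.cos θ) ↔
        (L₁ ^ 2 * e₂ * Real.cos δω - L₂ ^ 2 * e₁) * Real.cos θ
          + -(L₁ ^ 2 * e₂ * Real.sin δω) * Real.sin θ = L₂ ^ 2 - L₁ ^ 2 := by
    intro θ
    rw [Real.cos_add]
    constructor <;> intro h <;> linear_combination h
  have hamp : (L₁ ^ 2 * e₂ * Real.cos δω - L₂ ^ 2 * e₁) ^ 2 + (-(L₁ ^ 2 * e₂ * Real.sin δω)) ^ 2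
      - (L₂ ^ 2 - L₁ ^ 2) ^ 2 =
      2 * (L₁ ^ 2 * L₂ ^ 2) * (1 + L₂ ^ 2 * E₁ + L₁ ^ 2 * E₂ - e₁ * e₂ * Real.cos δω) := by
    linear_combination L₁ ^ 4 * e₂ ^ 2 * Real.sin_sq_add_cos_sq δω + L₂ ^ 4 * he₁ + L₁ ^ 4 * he₂
  rw [exists_congr hlin, exists_mul_cos_add_mul_sin_eq_iff, ← sub_nonneg, hamp,
    mul_nonneg_iff_of_pos_left hpos, sub_nonneg]
end

section
/- Let μ₁, μ₂ > 0 with μ₁ + μ₂ = 1, E < 0, L ≥ 0. If there exists an admissible state (E₁, E₂, L₁, L₂) with μ₁E₁ + μ₂E₂ = E, μ₁L₁ + μ₂L₂ = L and √(1 + 2E₁L₁²)·√(1 + 2E₂L₂²) ≥ −(1 + L₂²E₁ + L₁²E₂) (two intersecting co-focal orbits), then E·L² ≥ −1/2. -/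
/-- A radius with inverse `u` between the turning points of an orbit with angular momentum `a ≠ 0`
satisfies the effective potential bound. -/
lemma effective_potential_le {a e E u : ℝ} (ha : a ≠ 0) (he : e ^ 2 = 1 + 2 * E * a ^ 2)
    (h₁ : 1 - e ≤ a ^ 2 * u) (h₂ : a ^ 2 * u ≤ 1 + e) :
    a ^ 2 * u ^ 2 / 2 - u ≤ E := by
  have ha2 : 0 < a ^ 2 := by positivity
  refine le_of_mul_le_mul_left ?_ ha2
  nlinarith [mul_nonneg (sub_nonneg.2 h₁) (sub_nonneg.2 h₂)]

/-- The intersection condition, with denominators cleared. -/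
lemma abs_sub_le_of_intersect {a b e f E F : ℝ}
    (he₀ : 0 ≤ e) (hf₀ : 0 ≤ f)
    (he : e ^ 2 = 1 + 2 * E * a ^ 2) (hf : f ^ 2 = 1 + 2 * F * b ^ 2)
    (h : e * f ≥ -(1 + b ^ 2 * E + a ^ 2 * F)) :
    |b ^ 2 - a ^ 2| ≤ b ^ 2 * e + a ^ 2 * f := by
  refine abs_le_of_sq_le_sq ?_ (by positivity)
  have hab : 0 ≤ 2 * a ^ 2 * b ^ 2 := by positivity
  have key := mul_nonneg hab (by linarith : 0 ≤ e * f + (1 + b ^ 2 * E + a ^ 2 * F))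
  have hE : b ^ 4 * e ^ 2 = b ^ 4 * (1 + 2 * E * a ^ 2) := by rw [he]
  have hF : a ^ 4 * f ^ 2 = a ^ 4 * (1 + 2 * F * b ^ 2) := by rw [hf]
  nlinarith

/-- Intersecting orbits, one of them with nonzero angular momentum, share an inverse radius `u`
admitted by both effective potentials. -/
lemma exists_common_inverse_radius {a b e f E F : ℝ} (hb : b ≠ 0)
    (he₀ : 0 ≤ e) (hf₀ : 0 ≤ f)
    (he : e ^ 2 = 1 + 2 * E * a ^ 2) (hf : f ^ 2 = 1 + 2 * F * b ^ 2)
    (h : e * f ≥ -(1 + b ^ 2 * E + a ^ 2 * F)) :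
    ∃ u : ℝ, a ^ 2 * u ^ 2 / 2 - u ≤ E ∧ b ^ 2 * u ^ 2 / 2 - u ≤ F := by
  have hb2 : 0 < b ^ 2 := by positivity
  by_cases ha : a = 0
  · subst ha
    have he1 : e = 1 := by nlinarith
    subst he1
    have hu : b ^ 2 * ((1 + f) / b ^ 2) = 1 + f := by field_simp
    refine ⟨(1 + f) / b ^ 2, ?_, effective_potential_le hb hf (by linarith) hu.le⟩
    refine le_of_mul_le_mul_left ?_ hb2
    linarith
  have ha2 : 0 < a ^ 2 := by positivity
  obtain ⟨h₁, h₂⟩ := abs_le.1 (abs_sub_le_of_intersect he₀ hf₀ he hf h)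
  have hua : a ^ 2 * ((1 - e) / a ^ 2) = 1 - e := by field_simp
  have hub : b ^ 2 * ((1 - f) / b ^ 2) = 1 - f := by field_simp
  rcases le_total ((1 - e) / a ^ 2) ((1 - f) / b ^ 2) with hle | hle
  · refine ⟨(1 - f) / b ^ 2, effective_potential_le ha he ?_ ?_,
      effective_potential_le hb hf (by linarith) (by linarith)⟩
    · nlinarith
    · refine le_of_mul_le_mul_left ?_ hb2
      linear_combination h₁ + a ^ 2 * hub
  · refine ⟨(1 - e) / a ^ 2, effective_potential_le ha he (by linarith) (by linarith),
      effective_potential_le hb hf ?_ ?_⟩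
    · nlinarith
    · refine le_of_mul_le_mul_left ?_ ha2
      linear_combination h₂ + b ^ 2 * hua

theorem intersecting_orbits_lower_bound
    (μ₁ μ₂ E L : ℝ)
    (hμ₁ : 0 < μ₁) (hμ₂ : 0 < μ₂) (hsum : μ₁ + μ₂ = 1)
    (hE : E < 0) (hL : 0 ≤ L)
    (hex : ∃ E₁ E₂ L₁ L₂ : ℝ,
      1 + 2 * E₁ * L₁ ^ 2 ≥ 0 ∧ 1 + 2 * E₂ * L₂ ^ 2 ≥ 0 ∧
      μ₁ * E₁ + μ₂ * E₂ = E ∧ μ₁ * L₁ + μ₂ * L₂ = L ∧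
      Real.sqrt (1 + 2 * E₁ * L₁ ^ 2) * Real.sqrt (1 + 2 * E₂ * L₂ ^ 2) ≥
        -(1 + L₂ ^ 2 * E₁ + L₁ ^ 2 * E₂)) :
    E * L ^ 2 ≥ -(1 / 2) := by
  obtain ⟨E₁, E₂, a, b, h₁, h₂, rfl, rfl, h⟩ := hex
  have he := Real.sq_sqrt h₁
  have hf := Real.sq_sqrt h₂
  have he₀ := Real.sqrt_nonneg (1 + 2 * E₁ * a ^ 2)
  have hf₀ := Real.sqrt_nonneg (1 + 2 * E₂ * b ^ 2)
  by_cases hab : a = 0 ∧ b = 0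
  · obtain ⟨rfl, rfl⟩ := hab
    norm_num
  obtain ⟨u, hu₁, hu₂⟩ : ∃ u : ℝ, a ^ 2 * u ^ 2 / 2 - u ≤ E₁ ∧ b ^ 2 * u ^ 2 / 2 - u ≤ E₂ := by
    by_cases hb : b = 0
    · obtain ⟨u, hu⟩ := exists_common_inverse_radius (a := b) (b := a)
        (fun ha => hab ⟨ha, hb⟩) hf₀ he₀ hf he (by linarith)
      exact ⟨u, hu.symm⟩
    · exact exists_common_inverse_radius hb he₀ hf₀ he hf h
  have jensen : (μ₁ * a + μ₂ * b) ^ 2 ≤ μ₁ * a ^ 2 + μ₂ * b ^ 2 := by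
    obtain rfl : μ₂ = 1 - μ₁ := by linarith
    nlinarith [mul_nonneg (mul_pos hμ₁ hμ₂).le (sq_nonneg (a - b))]
  generalize μ₁ * a + μ₂ * b = L at *
  have hmean : L ^ 2 * u ^ 2 / 2 - u ≤ μ₁ * E₁ + μ₂ * E₂ := by
    have hu : (μ₁ + μ₂) * u = u := by rw [hsum, one_mul]
    linarith [mul_le_mul_of_nonneg_left hu₁ hμ₁.le, mul_le_mul_of_nonneg_left hu₂ hμ₂.le,
      mul_le_mul_of_nonneg_right jensen (sq_nonneg u)]
  linarith [mul_le_mul_of_nonneg_right hmean (sq_nonneg L), sq_nonneg (L ^ 2 * u - 1)]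
end

section
/- Fix μ₁, μ₂ > 0 with μ₁ + μ₂ = 1, reals E₁, E₂ and L, and define for δL ∈ ℝ: L₁(δL) = L + μ₂δL, L₂(δL) = L − μ₁δL, eᵢ(δL) = √(1 + 2EᵢLᵢ(δL)²), and d̄(δL) = L₁(δL)²/(1 + e₁(δL)) − L₂(δL)²/(1 − e₂(δL)). At any point δL₀ where e₁(δL₀) > 0 and 0 < e₂(δL₀) < 1, the function d̄ is differentiable with derivative d̄'(δL₀) = (μ₂/e₁(δL₀))·L₁(δL₀) − (μ₁/e₂(δL₀))·L₂(δL₀). -/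
/-- For `s = ±1` and `e = √(1 + 2 E x²)`, the apsidal distance `x² / (1 + s e)` has derivative
`s x / e` with respect to the angular momentum `x`. -/
theorem hasDerivAt_sq_div_one_add_mul_sqrt {E x s : ℝ} (hs : s ^ 2 = 1)
    (he : 0 < Real.sqrt (1 + 2 * E * x ^ 2))
    (hne : 1 + s * Real.sqrt (1 + 2 * E * x ^ 2) ≠ 0) :
    HasDerivAt (fun y : ℝ => y ^ 2 / (1 + s * Real.sqrt (1 + 2 * E * y ^ 2)))
      (s * x / Real.sqrt (1 + 2 * E * x ^ 2)) x := by
  have hpos := Real.sqrt_pos.mp he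
  have hsq := Real.sq_sqrt hpos.le
  have hpow : HasDerivAt (fun y : ℝ => y ^ 2) (2 * x) x := by
    simpa using hasDerivAt_pow 2 x
  have hsqrt := ((hpow.const_mul (2 * E)).const_add 1).sqrt hpos.ne'
  refine (hpow.div ((hsqrt.const_mul s).const_add 1) hne).congr_deriv ?_
  generalize Real.sqrt (1 + 2 * E * x ^ 2) = e at *
  have he' := he.ne'
  field_simp
  linear_combination s * x * hsq - e * x * (2 + s * e) * hs


theorem dbar_derivative
    (μ₁ μ₂ E₁ E₂ L δL₀ : ℝ)
    (hμ₁ : 0 < μ₁) (hμ₂ : 0 < μ₂) (hsum : μ₁ + μ₂ = 1)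
    (he₁ : 0 < Real.sqrt (1 + 2 * E₁ * (L + μ₂ * δL₀) ^ 2))
    (he₂pos : 0 < Real.sqrt (1 + 2 * E₂ * (L - μ₁ * δL₀) ^ 2))
    (he₂lt : Real.sqrt (1 + 2 * E₂ * (L - μ₁ * δL₀) ^ 2) < 1) :
    HasDerivAt
      (fun δL : ℝ =>
        (L + μ₂ * δL) ^ 2 / (1 + Real.sqrt (1 + 2 * E₁ * (L + μ₂ * δL) ^ 2)) -
        (L - μ₁ * δL) ^ 2 / (1 - Real.sqrt (1 + 2 * E₂ * (L - μ₁ * δL) ^ 2)))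
      (μ₂ / Real.sqrt (1 + 2 * E₁ * (L + μ₂ * δL₀) ^ 2) * (L + μ₂ * δL₀) -
        μ₁ / Real.sqrt (1 + 2 * E₂ * (L - μ₁ * δL₀) ^ 2) * (L - μ₁ * δL₀))
      δL₀ := by
  have h₁ : HasDerivAt (fun δL : ℝ => L + μ₂ * δL) μ₂ δL₀ := by
    simpa using ((hasDerivAt_id δL₀).const_mul μ₂).const_add L
  have h₂ : HasDerivAt (fun δL : ℝ => L - μ₁ * δL) (-μ₁) δL₀ := by
    simpa using ((hasDerivAt_id δL₀).const_mul μ₁).const_sub L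
  have d₁ := (hasDerivAt_sq_div_one_add_mul_sqrt (s := 1) (by norm_num) he₁
    (by positivity)).comp δL₀ h₁
  have d₂ := (hasDerivAt_sq_div_one_add_mul_sqrt (s := -1) (by norm_num) he₂pos
    (by linarith)).comp δL₀ h₂
  refine ((d₁.sub d₂).congr_deriv (by ring)).congr_of_eventuallyEq (.of_forall fun δL => ?_)
  simp [sub_eq_add_neg]
end

section
/- Let 0 < μ₁ ≤ μ₂ with μ₁ + μ₂ = 1 and L > 0. Suppose E₁, E₂ ∈ ℝ and L₁, L₂ > 0 satisfy: μ₁L₁ + μ₂L₂ = L; e₁ = √(1 + 2E₁L₁²) = 1; e₂ = √(1 + 2E₂L₂²) ∈ (0,1); the criticality condition μ₂L₁/e₁ = μ₁L₂/e₂; and the tangency condition L₁²/(1 + e₁) = L₂²/(1 − e₂). Then e₂ satisfies 2μ₂²e₂² = μ₁²(1 − e₂), and the mean energy E = μ₁E₁ + μ₂E₂ satisfies E·L² = −(1 − e₂²)(μ₁² + μ₂²e₂)²/(2μ₂e₂²), i.e. E·L² = σ(μ₁,μ₂). -/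
/-- `eCrit μ₁ μ₂` is the only positive root of `2μ₂²e² = μ₁²(1 − e)`. -/
theorem eq_eCrit {μ₁ μ₂ e : ℝ} (hμ₂ : 0 < μ₂) (he : 0 < e)
    (h : 2 * μ₂ ^ 2 * e ^ 2 = μ₁ ^ 2 * (1 - e)) : e = eCrit μ₁ μ₂ := by
  have hr : 2 * e ^ 2 = (μ₁ / μ₂) ^ 2 * (1 - e) := by
    field_simp
    linarith
  have hsq : (μ₁ / μ₂) ^ 4 + 8 * (μ₁ / μ₂) ^ 2 = (4 * e + (μ₁ / μ₂) ^ 2) ^ 2 := by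
    linear_combination (-8) * hr
  rw [eCrit, hsq, Real.sqrt_sq (by positivity)]
  ring

theorem critical_configuration
    (μ₁ μ₂ L E₁ E₂ L₁ L₂ : ℝ)
    (hμ₁ : 0 < μ₁) (hμ₁₂ : μ₁ ≤ μ₂) (hsum : μ₁ + μ₂ = 1) (hL : 0 < L)
    (hL₁ : 0 < L₁) (hL₂ : 0 < L₂)
    (hLmean : μ₁ * L₁ + μ₂ * L₂ = L)
    (he₁ : Real.sqrt (1 + 2 * E₁ * L₁ ^ 2) = 1)
    (he₂ : Real.sqrt (1 + 2 * E₂ * L₂ ^ 2) ∈ Set.Ioo (0 : ℝ) 1)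
    (hcrit : μ₂ * L₁ / Real.sqrt (1 + 2 * E₁ * L₁ ^ 2) =
      μ₁ * L₂ / Real.sqrt (1 + 2 * E₂ * L₂ ^ 2))
    (htan : L₁ ^ 2 / (1 + Real.sqrt (1 + 2 * E₁ * L₁ ^ 2)) =
      L₂ ^ 2 / (1 - Real.sqrt (1 + 2 * E₂ * L₂ ^ 2))) :
    (2 * μ₂ ^ 2 * Real.sqrt (1 + 2 * E₂ * L₂ ^ 2) ^ 2 =
      μ₁ ^ 2 * (1 - Real.sqrt (1 + 2 * E₂ * L₂ ^ 2))) ∧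
    ((μ₁ * E₁ + μ₂ * E₂) * L ^ 2 =
      -((1 - Real.sqrt (1 + 2 * E₂ * L₂ ^ 2) ^ 2) *
        (μ₁ ^ 2 + μ₂ ^ 2 * Real.sqrt (1 + 2 * E₂ * L₂ ^ 2)) ^ 2) /
      (2 * μ₂ * Real.sqrt (1 + 2 * E₂ * L₂ ^ 2) ^ 2)) ∧
    (μ₁ * E₁ + μ₂ * E₂) * L ^ 2 = sigma μ₁ μ₂ := by
  obtain ⟨he_pos, he_lt⟩ := he₂
  have hE₁ : E₁ = 0 := by
    rw [Real.sqrt_eq_one] at he₁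
    have h : E₁ * L₁ ^ 2 = 0 := by linarith
    exact (mul_eq_zero.mp h).resolve_right (by positivity)
  have hsq := Real.sq_sqrt (Real.sqrt_pos.mp he_pos).le
  rw [he₁] at hcrit htan
  generalize Real.sqrt (1 + 2 * E₂ * L₂ ^ 2) = e at *
  have hμ₂ : 0 < μ₂ := hμ₁.trans_le hμ₁₂
  have h1e : 1 - e ≠ 0 := by linarith
  have hL₁_eq : L₁ = μ₁ * L₂ / (μ₂ * e) := by
    field_simp at hcrit ⊢
    linarith
  have hquad : 2 * μ₂ ^ 2 * e ^ 2 = μ₁ ^ 2 * (1 - e) := by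
    rw [hL₁_eq] at htan
    field_simp at htan
    linarith
  have hE₂ : E₂ = (e ^ 2 - 1) / (2 * L₂ ^ 2) := by
    field_simp
    linarith
  have henergy : (μ₁ * E₁ + μ₂ * E₂) * L ^ 2 =
      -((1 - e ^ 2) * (μ₁ ^ 2 + μ₂ ^ 2 * e) ^ 2) / (2 * μ₂ * e ^ 2) := by
    rw [← hLmean, hE₁, hE₂, hL₁_eq]
    field_simp
    ring
  refine ⟨hquad, henergy, ?_⟩
  rw [henergy, sigma, ← eq_eCrit hμ₂ he_pos hquad]
end

section
/- Let 0 < μ₁ ≤ μ₂ with μ₁ + μ₂ = 1, let 𝐋₁, 𝐋₂ be vectors in ℝ³ and E₁, E₂ real numbers with 1 + 2E₁‖𝐋₁‖² ≥ 0 and 1 + 2E₂‖𝐋₂‖² ≥ 0, and set E = μ₁E₁ + μ₂E₂, 𝐋 = μ₁𝐋₁ + μ₂𝐋₂, eᵢ = √(1 + 2Eᵢ‖𝐋ᵢ‖²). If E < 0, E·‖𝐋‖² < σ(μ₁,μ₂), and e₁e₂ ≥ −(1 + ‖𝐋₂‖²E₁ + ‖𝐋₁‖²E₂), then E₁ < 0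 and E₂ < 0. -/
open Real

/-- The intersection condition says that `P = y a²` lies between `(1 - c) (1 - d) / 2 ≤ 0` and
`(1 + c) (1 + d) / 2`. -/
lemma two_mul_le_of_intersect {a b c d x y : ℝ} (hx : 0 ≤ x) (hy : 0 < y)
    (hc0 : 0 ≤ c) (hd0 : 0 ≤ d) (hc : c ^ 2 = 1 + 2 * x * a ^ 2) (hd : d ^ 2 = 1 - 2 * y * b ^ 2)
    (h : y * a ^ 2 ≤ 1 + x * b ^ 2 + c * d) : 2 * (y * a ^ 2) ≤ (1 + c) * (1 + d) := by
  have hc1 : 1 ≤ c := by nlinarith [mul_nonneg hx (sq_nonneg a)]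
  have hd1 : d ≤ 1 := by nlinarith [mul_nonneg hy.le (sq_nonneg b)]
  have hP : 0 ≤ y * a ^ 2 := by positivity
  have hprod : (2 * (y * a ^ 2) - (1 + c) * (1 + d)) * (2 * (y * a ^ 2) + (c - 1) * (1 - d)) ≤ 0 := by
    have h1 : 4 * ((y * a ^ 2) * (y * a ^ 2)) ≤ 4 * ((y * a ^ 2) * (1 + x * b ^ 2 + c * d)) := by
      gcongr
    have h2 : (c ^ 2 - 1) * (1 - d ^ 2) = 4 * (y * a ^ 2 * (x * b ^ 2)) := by
      rw [hc, hd]; ring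
    nlinarith
  by_contra! hlt
  have h3 : 0 < 2 * (y * a ^ 2) + (c - 1) * (1 - d) := by
    have : 0 ≤ (c - 1) * (1 - d) := mul_nonneg (by linarith) (by linarith)
    have : 0 < (1 + c) * (1 + d) := by positivity
    linarith
  exact absurd hprod (not_le.mpr (mul_pos (by linarith) h3))

lemma mul_sq_le_of_intersect {a b c d x y : ℝ} (hx : 0 ≤ x) (hy : 0 < y)
    (hc0 : 0 ≤ c) (hd0 : 0 ≤ d) (hc : c ^ 2 = 1 + 2 * x * a ^ 2) (hd : d ^ 2 = 1 - 2 * y * b ^ 2)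
    (h : y * a ^ 2 ≤ 1 + x * b ^ 2 + c * d) :
    y * a ^ 2 ≤ (1 + d) * (1 + x * ((1 + d) / 2) / y) := by
  have hP := two_mul_le_of_intersect hx hy hc0 hd0 hc hd h
  have hc' : c - 1 ≤ x * (1 + d) / y := by
    rw [le_div_iff₀ hy]
    have h1 : (c - 1) * y * (1 + c) ≤ x * (1 + d) * (1 + c) := by
      have : x * (2 * (y * a ^ 2)) ≤ x * ((1 + c) * (1 + d)) := by gcongr
      nlinarith
    exact le_of_mul_le_mul_right h1 (by linarith)
  have h2 : (1 + d) * (c - 1) ≤ (1 + d) * (x * (1 + d) / y) := by gcongr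
  have h3 : (1 + d) * (x * (1 + d) / y) = 2 * ((1 + d) * (x * ((1 + d) / 2) / y)) := by ring
  nlinarith

/-- For `s² + r q²` fixed, `r q + s` grows as `q ≥ 1` decreases to `1`. -/
lemma mul_add_le_add_of_sq_eq {r q s t : ℝ} (hr : 0 < r) (hq : 1 ≤ q) (hs : 0 ≤ s) (ht : 0 ≤ t)
    (ht1 : t ≤ 1) (h : t ^ 2 = s ^ 2 + r * (q ^ 2 - 1)) : r * q + s ≤ r + t := by
  have hst : s ≤ t := by
    rw [← sq_le_sq₀ hs ht]
    have : 0 ≤ q ^ 2 - 1 := by nlinarith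
    nlinarith [mul_nonneg hr.le this]
  by_contra! hlt
  rcases ht.eq_or_lt with h0 | h0
  · subst h0
    nlinarith [mul_pos hr (by nlinarith : 0 < q - 1)]
  · nlinarith [mul_pos (by linarith : 0 < r * (q - 1) - (t - s)) (by linarith : 0 < t + s),
      mul_nonneg (mul_nonneg hr.le (sub_nonneg.mpr hq)) (by linarith : 0 ≤ q + 1 - t - s)]

/-- Two intersecting orbits with energies `x ≥ 0` and `-y < 0` and negative total energy obey the
same bound as a parabolic orbit and an elliptic one whose apoapsis touches it. -/
lemma exists_energy_momentum_le {m₁ m₂ a b c d x y : ℝ} (hm₁ : 0 < m₁) (hm₂ : 0 < m₂)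
    (ha : 0 ≤ a) (hb : 0 ≤ b) (hx : 0 ≤ x) (hxy : m₁ * x < m₂ * y)
    (hc0 : 0 ≤ c) (hd0 : 0 ≤ d) (hc : c ^ 2 = 1 + 2 * x * a ^ 2) (hd : d ^ 2 = 1 - 2 * y * b ^ 2)
    (h : y * a ^ 2 ≤ 1 + x * b ^ 2 + c * d) :
    ∃ t : ℝ, 0 ≤ t ∧
      (m₂ * y - m₁ * x) * (m₁ * a + m₂ * b) ^ 2 ≤ 2 * m₂ * (1 - t ^ 2) * (m₁ + m₂ * t) ^ 2 := by
  have hy : 0 < y := by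
    have : 0 < m₂ * y := lt_of_le_of_lt (by positivity) hxy
    exact pos_of_mul_pos_right this hm₂.le
  have hd1 : d ≤ 1 := by nlinarith [mul_nonneg hy.le (sq_nonneg b)]
  have hA := mul_sq_le_of_intersect hx hy hc0 hd0 hc hd h
  set k := (1 + d) / 2 with hk
  have hk0 : 0 < k := by positivity
  set q := √(1 + x * k / y) with hq
  have hq2 : q ^ 2 = 1 + x * k / y := sq_sqrt (by positivity)
  have hq1 : 1 ≤ q := by
    rw [hq, one_le_sqrt]
    have : 0 ≤ x * k / y := by positivity
    linarith
  set s := √((1 - d) / 2) with hs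
  have hs0 : 0 ≤ s := sqrt_nonneg _
  have hs2 : s ^ 2 = 1 - k := by rw [hs, sq_sqrt (by linarith), hk]; ring
  set g := √(2 * k / y) with hg
  have hg0 : 0 ≤ g := sqrt_nonneg _
  have hg2 : g ^ 2 = 2 * k / y := sq_sqrt (by positivity)
  have hag : a ≤ g * q := by
    rw [← sq_le_sq₀ ha (by positivity), mul_pow, hg2, hq2, div_mul_eq_mul_div, le_div_iff₀ hy]
    have : 1 + d = 2 * k := by rw [hk]; ring
    rw [this] at hA
    linarith
  have hbg : b ≤ g * s := by
    rw [← sq_le_sq₀ hb (by positivity), mul_pow, hg2, hs2, div_mul_eq_mul_div, le_div_iff₀ hy, hk]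
    nlinarith
  set r := m₁ / m₂ with hr
  have hr0 : 0 < r := by positivity
  have hmr : m₁ = m₂ * r := by rw [hr]; field_simp
  have hrxy : r * x < y := by
    rw [hmr] at hxy
    nlinarith
  have hT0 : 0 ≤ s ^ 2 + r * (q ^ 2 - 1) := by
    have : 0 ≤ q ^ 2 - 1 := by nlinarith
    positivity
  have hT : 1 - (s ^ 2 + r * (q ^ 2 - 1)) = (y - r * x) * k / y := by
    rw [hs2, hq2]; field_simp; ring
  set t := √(s ^ 2 + r * (q ^ 2 - 1)) with ht
  have ht0 : 0 ≤ t := sqrt_nonneg _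
  have ht2 : t ^ 2 = s ^ 2 + r * (q ^ 2 - 1) := sq_sqrt hT0
  have hT1 : 0 ≤ 1 - t ^ 2 := by
    rw [ht2, hT]
    have : 0 < y - r * x := by linarith
    positivity
  have ht1 : t ≤ 1 := by nlinarith
  refine ⟨t, ht0, ?_⟩
  calc (m₂ * y - m₁ * x) * (m₁ * a + m₂ * b) ^ 2
      ≤ (m₂ * y - m₁ * x) * (m₁ * (g * q) + m₂ * (g * s)) ^ 2 := by
        gcongr
    _ = 2 * m₂ * ((y - r * x) * k / y) * (m₂ * (r * q + s)) ^ 2 := by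
        have : (m₁ * (g * q) + m₂ * (g * s)) ^ 2 = g ^ 2 * (m₂ * (r * q + s)) ^ 2 := by
          rw [hmr]; ring
        rw [this, hg2, hmr]; ring
    _ = 2 * m₂ * (1 - t ^ 2) * (m₂ * (r * q + s)) ^ 2 := by rw [ht2, hT]
    _ ≤ 2 * m₂ * (1 - t ^ 2) * (m₂ * (r + t)) ^ 2 := by
        have := mul_add_le_add_of_sq_eq hr0 hq1 hs0 ht0 ht1 ht2
        gcongr
    _ = 2 * m₂ * (1 - t ^ 2) * (m₁ + m₂ * t) ^ 2 := by rw [hmr]; ring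

lemma eCrit_spec_s15 {m₁ m₂ : ℝ} (hm₁ : 0 < m₁) (hm₂ : 0 < m₂) :
    0 < eCrit m₁ m₂ ∧ eCrit m₁ m₂ < 1 ∧
      m₁ ^ 2 * (1 - eCrit m₁ m₂) = 2 * (m₂ * eCrit m₁ m₂) ^ 2 := by
  set R := (m₁ / m₂) ^ 2 with hR
  have hR0 : 0 < R := by positivity
  have he : eCrit m₁ m₂ = (√(R ^ 2 + 8 * R) - R) / 4 := by
    rw [eCrit, hR]; ring_nf
  have hm : m₁ ^ 2 = R * m₂ ^ 2 := by rw [hR]; field_simp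
  have hq2 : √(R ^ 2 + 8 * R) ^ 2 = R ^ 2 + 8 * R := sq_sqrt (by positivity)
  have hlt : R < √(R ^ 2 + 8 * R) := lt_sqrt_of_sq_lt (by linarith)
  have hlt' : √(R ^ 2 + 8 * R) < R + 4 := by
    rw [sqrt_lt' (by positivity)]; nlinarith
  rw [he]
  refine ⟨by linarith, by linarith, ?_⟩
  rw [hm]
  linear_combination (-m₂ ^ 2 / 8) * hq2

lemma sigma_le {m₁ m₂ t : ℝ} (hm₁ : 0 < m₁) (hm₂ : 0 < m₂) :
    sigma m₁ m₂ ≤ -(2 * m₂ * (1 - t ^ 2) * (m₁ + m₂ * t) ^ 2) := by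
  obtain ⟨he0, he1, hspec⟩ := eCrit_spec_s15 hm₁ hm₂
  rw [sigma]
  set e := eCrit m₁ m₂
  clear_value e
  set s := √((1 - e) / 2) with hs
  have hs0 : 0 < s := sqrt_pos.mpr (by linarith)
  have hs2 : s ^ 2 = (1 - e) / 2 := sq_sqrt (by linarith)
  have hes : e = 1 - 2 * s ^ 2 := by linarith
  have hms : m₁ * s = m₂ * e := by
    rw [← sq_eq_sq₀ (by positivity) (by positivity)]
    rw [mul_pow, hs2]; linarith
  have hpoly : (1 - t ^ 2) * (1 - 2 * s ^ 2 + s * t) ^ 2 ≤ (1 - s ^ 2) ^ 3 := by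
    have h1 : 0 ≤ (t - s) ^ 2 * ((s * t + 1 - s ^ 2) ^ 2 + s ^ 2 * e) := by positivity
    rw [hes] at h1
    linarith
  have hnum : m₁ ^ 2 + m₂ ^ 2 * e = m₂ ^ 2 * e * (1 - s ^ 2) / s ^ 2 := by
    have : m₁ = m₂ * e / s := by field_simp; exact hms
    rw [this]
    field_simp
    rw [hes]; ring
  have hval : (1 - e ^ 2) * (m₁ ^ 2 + m₂ ^ 2 * e) ^ 2 / (2 * m₂ * e ^ 2)
      = 2 * m₂ ^ 3 * (1 - s ^ 2) ^ 3 / s ^ 2 := by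
    have : 1 - e ^ 2 = 4 * s ^ 2 * (1 - s ^ 2) := by rw [hes]; ring
    rw [hnum, this]
    field_simp
    ring
  rw [neg_div, hval, neg_le_neg_iff, le_div_iff₀ (by positivity)]
  calc 2 * m₂ * (1 - t ^ 2) * (m₁ + m₂ * t) ^ 2 * s ^ 2
      = 2 * m₂ * (1 - t ^ 2) * (m₁ * s + m₂ * t * s) ^ 2 := by ring
    _ = 2 * m₂ ^ 3 * ((1 - t ^ 2) * (1 - 2 * s ^ 2 + s * t) ^ 2) := by rw [hms, hes]; ring
    _ ≤ 2 * m₂ ^ 3 * (1 - s ^ 2) ^ 3 := by gcongr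

lemma exchanged_mass_bound {m₁ m₂ s : ℝ} (hm₁ : 0 < m₁) (hm : m₁ ≤ m₂) (hs : 0 ≤ s) :
    2 * m₁ * (1 - s ^ 2) * (m₂ + m₁ * s) ^ 2 ≤
      2 * m₂ * (1 - (1 / 2) ^ 2) * (m₁ + m₂ * (1 / 2)) ^ 2 := by
  obtain ⟨p, rfl⟩ : ∃ p, m₂ = m₁ + p := ⟨m₂ - m₁, by ring⟩
  have hp : 0 ≤ p := by linarith
  have h0 : (1 - s ^ 2) * (1 + s) ^ 2 ≤ 27 / 16 := by
    nlinarith [mul_nonneg (sq_nonneg (2 * s - 1)) (sq_nonneg (2 * s + 3)),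
      mul_nonneg (sq_nonneg (2 * s - 1)) hs, sq_nonneg (2 * s - 1)]
  have h1 : 2 * ((1 - s ^ 2) * (1 + s)) ≤ 45 / 16 := by
    nlinarith [mul_nonneg (sq_nonneg (3 * s - 1)) hs, sq_nonneg (3 * s - 1)]
  have h2 : 1 - s ^ 2 ≤ 21 / 16 := by nlinarith
  have e0 := mul_le_mul_of_nonneg_left h0 (by positivity : 0 ≤ m₁ ^ 3)
  have e1 := mul_le_mul_of_nonneg_left h1 (by positivity : 0 ≤ m₁ ^ 2 * p)
  have e2 := mul_le_mul_of_nonneg_left h2 (by positivity : 0 ≤ m₁ * p ^ 2)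
  have e3 : 0 ≤ p ^ 3 := by positivity
  nlinarith

/-- `Lv₁`, `Lv₂` are the specific angular momentum vectors of the two orbits in `ℝ³`. -/
theorem invariant_region_three_dimensional
    (μ₁ μ₂ : ℝ) (hμ₁ : 0 < μ₁) (hμ₁₂ : μ₁ ≤ μ₂) (hsum : μ₁ + μ₂ = 1)
    (Lv₁ Lv₂ : EuclideanSpace ℝ (Fin 3)) (E₁ E₂ : ℝ)
    (hadm₁ : 1 + 2 * E₁ * ‖Lv₁‖ ^ 2 ≥ 0) (hadm₂ : 1 + 2 * E₂ * ‖Lv₂‖ ^ 2 ≥ 0)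
    (hE : μ₁ * E₁ + μ₂ * E₂ < 0)
    (hσ : (μ₁ * E₁ + μ₂ * E₂) * ‖μ₁ • Lv₁ + μ₂ • Lv₂‖ ^ 2 < sigma μ₁ μ₂)
    (hint : Real.sqrt (1 + 2 * E₁ * ‖Lv₁‖ ^ 2) * Real.sqrt (1 + 2 * E₂ * ‖Lv₂‖ ^ 2) ≥
      -(1 + ‖Lv₂‖ ^ 2 * E₁ + ‖Lv₁‖ ^ 2 * E₂)) :
    E₁ < 0 ∧ E₂ < 0 := by
  set a := ‖Lv₁‖
  set b := ‖Lv₂‖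
  have ha0 : 0 ≤ a := norm_nonneg _
  have hb0 : 0 ≤ b := norm_nonneg _
  have hμ₂ : 0 < μ₂ := hμ₁.trans_le hμ₁₂
  have hL : ‖μ₁ • Lv₁ + μ₂ • Lv₂‖ ≤ μ₁ * a + μ₂ * b := by
    refine (norm_add_le _ _).trans_eq ?_
    rw [norm_smul, norm_smul, norm_of_nonneg hμ₁.le, norm_of_nonneg hμ₂.le]
  have hL2 : (μ₁ * E₁ + μ₂ * E₂) * (μ₁ * a + μ₂ * b) ^ 2 < sigma μ₁ μ₂ :=
    lt_of_le_of_lt (mul_le_mul_of_nonpos_left (by gcongr) hE.le) hσ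
  constructor
  · by_contra! hE₁
    obtain ⟨t, -, ht⟩ := exists_energy_momentum_le (x := E₁) (y := -E₂) hμ₁ hμ₂ ha0 hb0 hE₁
      (by linarith) (sqrt_nonneg _) (sqrt_nonneg _) (sq_sqrt hadm₁)
      ((sq_sqrt hadm₂).trans (by ring)) (by linarith)
    linarith [sigma_le hμ₁ hμ₂ (t := t)]
  · by_contra! hE₂
    obtain ⟨t, ht0, ht⟩ := exists_energy_momentum_le (x := E₂) (y := -E₁) hμ₂ hμ₁ hb0 ha0 hE₂
      (by linarith) (sqrt_nonneg _) (sqrt_nonneg _) (sq_sqrt hadm₂)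
      ((sq_sqrt hadm₁).trans (by ring)) (by linarith)
    linarith [sigma_le hμ₁ hμ₂ (t := 1 / 2), exchanged_mass_bound hμ₁ hμ₁₂ ht0]
end

section
/- Let μ₁, μ₂ > 0 with μ₁ + μ₂ = 1, E < 0, L > 0, and define the admissibility region A = { (δL, δE) ∈ ℝ² : 1 + 2(E + μ₂δE)(L + μ₂δL)² ≥ 0 and 1 + 2(E − μ₁δE)(L − μ₁δL)² ≥ 0 }. If E·L² < −1/2 then A is not a connected subset of ℝ², while if −1/2 ≤ E·L² < 0 then A is connected (and nonempty, since it contains (0,0)). -/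
/-- The admissibility region in the `(δL, δE)` plane: both eccentricities are real. -/
def admissibleRegion (μ₁ μ₂ E L : ℝ) : Set (ℝ × ℝ) :=
  {p : ℝ × ℝ |
    1 + 2 * (E + μ₂ * p.2) * (L + μ₂ * p.1) ^ 2 ≥ 0 ∧
    1 + 2 * (E - μ₁ * p.2) * (L - μ₁ * p.1) ^ 2 ≥ 0}

/-- Multiplying the two admissibility inequalities by `μ₁ L₂²` and `μ₂ L₁²` and adding them
eliminates `δE`. -/
lemma elimination_of_mem {μ₁ μ₂ E L x y : ℝ} (hμ₁ : 0 < μ₁) (hμ₂ : 0 < μ₂)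
    (hsum : μ₁ + μ₂ = 1) (h : (x, y) ∈ admissibleRegion μ₁ μ₂ E L) :
    0 ≤ μ₂ * (L + μ₂ * x) ^ 2 + μ₁ * (L - μ₁ * x) ^ 2
      + 2 * E * ((L + μ₂ * x) ^ 2 * (L - μ₁ * x) ^ 2) := by
  obtain ⟨h₁, h₂⟩ := h
  dsimp only at h₁ h₂
  generalize L + μ₂ * x = p at *
  generalize L - μ₁ * x = q at *
  have h₃ := mul_nonneg (mul_nonneg hμ₁.le (sq_nonneg q)) h₁
  have h₄ := mul_nonneg (mul_nonneg hμ₂.le (sq_nonneg p)) h₂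
  have : 2 * E * (p ^ 2 * q ^ 2) = (μ₁ + μ₂) * (2 * E * (p ^ 2 * q ^ 2)) := by
    rw [hsum, one_mul]
  rw [this]
  linarith

/-- A power mean inequality between the two weighted means of `p` and `q`. -/
lemma sq_mul_sq_le_weighted {a b p q : ℝ} (ha : 0 < a) (hb : 0 < b) (hab : a + b = 1)
    (hp : 0 ≤ p) (hq : 0 ≤ q) :
    p ^ 2 * q ^ 2 ≤ (b * p ^ 2 + a * q ^ 2) * (a * p + b * q) ^ 2 := by
  obtain rfl : b = 1 - a := by linarith
  have hquad : ((1 - a) * p + a * q) ^ 2 ≤ (1 - a) * p ^ 2 + a * q ^ 2 := by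
    nlinarith [mul_nonneg (mul_nonneg ha.le hb.le) (sq_nonneg (p - q))]
  have hprod : p * q ≤ ((1 - a) * p + a * q) * (a * p + (1 - a) * q) := by
    nlinarith [mul_nonneg (mul_nonneg ha.le hb.le) (sq_nonneg (p - q))]
  calc p ^ 2 * q ^ 2 = (p * q) ^ 2 := by ring
    _ ≤ (((1 - a) * p + a * q) * (a * p + (1 - a) * q)) ^ 2 :=
        pow_le_pow_left₀ (mul_nonneg hp hq) hprod 2
    _ = ((1 - a) * p + a * q) ^ 2 * (a * p + (1 - a) * q) ^ 2 := by ring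
    _ ≤ _ := mul_le_mul_of_nonneg_right hquad (sq_nonneg _)

lemma weighted_add_nonneg_of_le {a b c P Q P' Q' : ℝ} (ha : 0 < a) (hb : 0 < b)
    (hP : 0 < P) (hQ : 0 < Q) (hPP' : P ≤ P') (hQQ' : Q ≤ Q')
    (h : 0 ≤ b * P' + a * Q' + c * (P' * Q')) :
    0 ≤ b * P + a * Q + c * (P * Q) := by
  have hP' : 0 < P' := hP.trans_le hPP'
  have hQ' : 0 < Q' := hQ.trans_le hQQ'
  have h₁ : 0 ≤ b * (P * P') * (Q' - Q) :=
    mul_nonneg (by positivity) (sub_nonneg.2 hQQ')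
  have h₂ : 0 ≤ a * (Q * Q') * (P' - P) :=
    mul_nonneg (by positivity) (sub_nonneg.2 hPP')
  have h₃ := mul_nonneg (mul_pos hP hQ).le h
  refine nonneg_of_mul_nonneg_right (a := P' * Q') ?_ (mul_pos hP' hQ')
  linarith

lemma elimination_of_mem_uIcc {μ₁ μ₂ E L x x₀ : ℝ} (hμ₁ : 0 < μ₁) (hμ₂ : 0 < μ₂)
    (hsum : μ₁ + μ₂ = 1) (hL : 0 < L) (hEL : -(1 / 2) ≤ E * L ^ 2)
    (hx : x ∈ Set.uIcc 0 x₀) (hpos : 0 < L + μ₂ * x)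
    (h : 0 ≤ μ₂ * (L + μ₂ * x₀) ^ 2 + μ₁ * (L - μ₁ * x₀) ^ 2
      + 2 * E * ((L + μ₂ * x₀) ^ 2 * (L - μ₁ * x₀) ^ 2)) :
    0 ≤ μ₂ * (L + μ₂ * x) ^ 2 + μ₁ * (L - μ₁ * x) ^ 2
      + 2 * E * ((L + μ₂ * x) ^ 2 * (L - μ₁ * x) ^ 2) := by
  rcases le_or_gt 0 (L - μ₁ * x) with hq | hq
  · have hmean := sq_mul_sq_le_weighted hμ₁ hμ₂ hsum hpos.le hq
    have hLeq : μ₁ * (L + μ₂ * x) + μ₂ * (L - μ₁ * x) = L := by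
      linear_combination L * hsum
    rw [hLeq] at hmean
    generalize L + μ₂ * x = p at *
    generalize L - μ₁ * x = q at *
    have hc := mul_nonneg (mul_nonneg (sq_nonneg p) (sq_nonneg q))
      (by linarith : 0 ≤ 1 + 2 * (E * L ^ 2))
    refine nonneg_of_mul_nonneg_right (a := L ^ 2) ?_ (by positivity)
    linarith
  · have hx0 : 0 < x := by
      by_contra! hx0
      nlinarith
    have hxx₀ : x ≤ x₀ := by
      rcases Set.mem_uIcc.1 hx with hx' | hx'
      · exact hx'.2
      · linarith [hx'.2]
    have h₁ := mul_le_mul_of_nonneg_left hxx₀ hμ₁.le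
    have h₂ := mul_le_mul_of_nonneg_left hxx₀ hμ₂.le
    refine weighted_add_nonneg_of_le hμ₁ hμ₂ (by positivity) (sq_pos_of_neg hq) ?_ ?_ h
    · exact pow_le_pow_left₀ hpos.le (by linarith) 2
    · nlinarith

/-- The value of `δE` at which the first orbit is circular. -/
noncomputable def circularEnergy (μ₂ E L x : ℝ) : ℝ :=
  (-1 / (2 * (L + μ₂ * x) ^ 2) - E) / μ₂

lemma circularEnergy_mem {μ₁ μ₂ E L x : ℝ} (hμ₂ : 0 < μ₂) (hsum : μ₁ + μ₂ = 1)
    (hpos : 0 < L + μ₂ * x)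
    (h : 0 ≤ μ₂ * (L + μ₂ * x) ^ 2 + μ₁ * (L - μ₁ * x) ^ 2
      + 2 * E * ((L + μ₂ * x) ^ 2 * (L - μ₁ * x) ^ 2)) :
    (x, circularEnergy μ₂ E L x) ∈ admissibleRegion μ₁ μ₂ E L := by
  simp only [admissibleRegion, circularEnergy, Set.mem_ofPred_eq]
  generalize L + μ₂ * x = p at *
  generalize L - μ₁ * x = q at *
  constructor
  · apply ge_of_eq
    field_simp
    ring
  · have : 1 + 2 * (E - μ₁ * ((-1 / (2 * p ^ 2) - E) / μ₂)) * q ^ 2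
        = (μ₂ * p ^ 2 + μ₁ * q ^ 2 + 2 * E * (p ^ 2 * q ^ 2)) / (μ₂ * p ^ 2) := by
      field_simp
      linear_combination 2 * E * p ^ 2 * q ^ 2 * hsum
    rw [this]
    positivity

lemma isPreconnected_fiber (μ₁ μ₂ E L x : ℝ) :
    IsPreconnected (Prod.mk x '' {y | (x, y) ∈ admissibleRegion μ₁ μ₂ E L}) := by
  refine IsPreconnected.image (Convex.isPreconnected ?_) _ (by fun_prop)
  rintro y ⟨hy₁, hy₂⟩ z ⟨hz₁, hz₂⟩ a b ha hb hab
  obtain rfl : b = 1 - a := by linarith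
  simp only [smul_eq_mul, admissibleRegion, Set.mem_ofPred_eq] at *
  constructor
  · linarith [mul_nonneg ha hy₁, mul_nonneg hb hz₁]
  · linarith [mul_nonneg ha hy₂, mul_nonneg hb hz₂]

lemma zero_mem_admissibleRegion {μ₁ μ₂ E L : ℝ} (hEL : -(1 / 2) ≤ E * L ^ 2) :
    (0, 0) ∈ admissibleRegion μ₁ μ₂ E L := by
  simp only [admissibleRegion, Set.mem_ofPred_eq, mul_zero, add_zero, sub_zero]
  constructor <;> linarith

/-- A point with `L₁ > 0` can be connected to the origin: move vertically until the first orbit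
is circular, keep it circular while `δL` goes to zero, then move vertically again. -/
lemma exists_isPreconnected_of_pos {μ₁ μ₂ E L x y : ℝ} (hμ₁ : 0 < μ₁) (hμ₂ : 0 < μ₂)
    (hsum : μ₁ + μ₂ = 1) (hL : 0 < L) (hEL : -(1 / 2) ≤ E * L ^ 2)
    (h : (x, y) ∈ admissibleRegion μ₁ μ₂ E L) (hpos : 0 < L + μ₂ * x) :
    ∃ t ⊆ admissibleRegion μ₁ μ₂ E L, (0, 0) ∈ t ∧ (x, y) ∈ t ∧ IsPreconnected t := by
  let fiber (x : ℝ) := Prod.mk x '' {y | (x, y) ∈ admissibleRegion μ₁ μ₂ E L}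
  let graph := (fun u ↦ (u, circularEnergy μ₂ E L u)) '' Set.uIcc 0 x
  have hfiber (x) : fiber x ⊆ admissibleRegion μ₁ μ₂ E L := by
    rintro _ ⟨_, hy, rfl⟩
    exact hy
  have hposI : ∀ u ∈ Set.uIcc 0 x, 0 < L + μ₂ * u := by
    intro u hu
    rcases Set.mem_uIcc.1 hu with ⟨hu, -⟩ | ⟨hu, -⟩
    · positivity
    · linarith [mul_le_mul_of_nonneg_left hu hμ₂.le]
  have hmem : ∀ u ∈ Set.uIcc 0 x, (u, circularEnergy μ₂ E L u) ∈ admissibleRegion μ₁ μ₂ E L :=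
    fun u hu ↦ circularEnergy_mem hμ₂ hsum (hposI u hu)
      (elimination_of_mem_uIcc hμ₁ hμ₂ hsum hL hEL hu (hposI u hu)
        (elimination_of_mem hμ₁ hμ₂ hsum h))
  have hgraph : IsPreconnected graph := by
    refine isPreconnected_uIcc.image _ (continuousOn_id.prodMk ?_)
    unfold circularEnergy
    refine ((continuousOn_const.div (by fun_prop) fun u hu ↦ ?_).sub
      continuousOn_const).div_const _
    have := hposI u hu
    positivity
  refine ⟨fiber 0 ∪ graph ∪ fiber x, ?_, ?_, ?_, ?_⟩
  · refine Set.union_subset (Set.union_subset (hfiber 0) ?_) (hfiber x)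
    rintro _ ⟨u, hu, rfl⟩
    exact hmem u hu
  · exact Or.inl (Or.inl ⟨0, zero_mem_admissibleRegion hEL, rfl⟩)
  · exact Or.inr ⟨y, h, rfl⟩
  · refine IsPreconnected.union (x, circularEnergy μ₂ E L x)
      (Or.inr ⟨x, Set.right_mem_uIcc, rfl⟩) ⟨_, hmem x Set.right_mem_uIcc, rfl⟩ ?_
      (isPreconnected_fiber _ _ _ _ _)
    exact IsPreconnected.union (0, circularEnergy μ₂ E L 0)
      ⟨_, hmem 0 Set.left_mem_uIcc, rfl⟩ ⟨0, Set.left_mem_uIcc, rfl⟩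
      (isPreconnected_fiber _ _ _ _ _) hgraph

/-- Exchanging the two orbits reverses the signs of `δL` and `δE`. -/
lemma neg_mem_admissibleRegion_swap {μ₁ μ₂ E L : ℝ} {p : ℝ × ℝ}
    (h : p ∈ admissibleRegion μ₁ μ₂ E L) : -p ∈ admissibleRegion μ₂ μ₁ E L := by
  simpa [admissibleRegion, ← sub_eq_add_neg, and_comm] using h

lemma isPreconnected_admissibleRegion {μ₁ μ₂ E L : ℝ} (hμ₁ : 0 < μ₁) (hμ₂ : 0 < μ₂)
    (hsum : μ₁ + μ₂ = 1) (hL : 0 < L) (hEL : -(1 / 2) ≤ E * L ^ 2) :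
    IsPreconnected (admissibleRegion μ₁ μ₂ E L) := by
  refine isPreconnected_of_forall (0, 0) ?_
  rintro ⟨x, y⟩ h
  rcases lt_or_ge 0 (L + μ₂ * x) with hpos | hneg
  · exact exists_isPreconnected_of_pos hμ₁ hμ₂ hsum hL hEL h hpos
  · have hx : x < 0 := by
      by_contra! hx
      nlinarith
    obtain ⟨t, ht, h0, hxy, hconn⟩ := exists_isPreconnected_of_pos (x := -x) (y := -y) hμ₂ hμ₁
      (by rwa [add_comm]) hL hEL (neg_mem_admissibleRegion_swap h) (by nlinarith)
    refine ⟨Neg.neg '' t, ?_, ⟨_, h0, by simp⟩, ⟨_, hxy, by simp⟩,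
      hconn.image _ continuous_neg.continuousOn⟩
    rintro _ ⟨p, hp, rfl⟩
    exact neg_mem_admissibleRegion_swap (ht hp)

/-- When `L₂ = 0` the second constraint is void, so the fiber is nonempty. -/
lemma div_mem_fst_image {μ₁ μ₂ E L : ℝ} (hμ₁ : 0 < μ₁) (hμ₂ : 0 < μ₂) :
    L / μ₁ ∈ Prod.fst '' admissibleRegion μ₁ μ₂ E L := by
  refine ⟨(L / μ₁, -E / μ₂), ⟨?_, ?_⟩, rfl⟩ <;> dsimp only
  · rw [mul_div_cancel₀ _ hμ₂.ne']
    simp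
  · rw [mul_div_cancel₀ _ hμ₁.ne']
    simp

lemma not_isPreconnected_admissibleRegion {μ₁ μ₂ E L : ℝ} (hμ₁ : 0 < μ₁) (hμ₂ : 0 < μ₂)
    (hsum : μ₁ + μ₂ = 1) (hL : 0 < L) (hEL : E * L ^ 2 < -(1 / 2)) :
    ¬ IsPreconnected (admissibleRegion μ₁ μ₂ E L) := by
  intro hconn
  have hleft : -(L / μ₂) ∈ Prod.fst '' admissibleRegion μ₁ μ₂ E L := by
    obtain ⟨p, hp, hpx⟩ := div_mem_fst_image (E := E) (L := L) hμ₂ hμ₁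
    exact ⟨-p, neg_mem_admissibleRegion_swap hp, by simp [hpx]⟩
  obtain ⟨⟨x, y⟩, hxy, hx⟩ :=
    (hconn.image Prod.fst continuous_fst.continuousOn).Icc_subset hleft
      (div_mem_fst_image hμ₁ hμ₂)
      ⟨neg_nonpos.2 (div_pos hL hμ₂).le, (div_pos hL hμ₁).le⟩
  obtain rfl : x = 0 := hx
  have h := elimination_of_mem hμ₁ hμ₂ hsum hxy
  have hsq : 0 < L ^ 2 := by positivity
  have : 0 ≤ L ^ 2 * (1 + 2 * (E * L ^ 2)) := by
    linear_combination h + L ^ 2 * hsum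
  nlinarith

theorem admissible_region_connectedness
    (μ₁ μ₂ E L : ℝ)
    (hμ₁ : 0 < μ₁) (hμ₂ : 0 < μ₂) (hsum : μ₁ + μ₂ = 1)
    (hE : E < 0) (hL : 0 < L) :
    (E * L ^ 2 < -(1 / 2) → ¬ IsPreconnected (admissibleRegion μ₁ μ₂ E L)) ∧
    (-(1 / 2) ≤ E * L ^ 2 →
      (0, 0) ∈ admissibleRegion μ₁ μ₂ E L ∧ IsConnected (admissibleRegion μ₁ μ₂ E L)) :=
  ⟨not_isPreconnected_admissibleRegion hμ₁ hμ₂ hsum hL, fun hEL ↦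
    ⟨zero_mem_admissibleRegion hEL, ⟨_, zero_mem_admissibleRegion hEL⟩,
      isPreconnected_admissibleRegion hμ₁ hμ₂ hsum hL hEL⟩⟩
end
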